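/- arXiv:2212.10303 — 2 statements merged into one kernel-verified Lean document; each statement's English description precedes it below -/
import Mathlib

section
/- Let U ⊂ ℝⁿ be open and f ∈ C²(U, ℝ). Suppose that for some b ∈ ℝ the sublevel set f^b := {x ∈ U : f(x) < b} has compact closure contained in U, and that f has no critical points on f^{-1}(b). Then the Brouwer degree of the gradient vector field satisfies deg(∇f, f^b, 0) = χ(f^b), where χ denotes the Euler characteristic. -/
open CategoryTheory AlgebraicTopology

/-- Rational singular chain complex of a topological space. -/
noncomputable def singularChains (X : Type) [TopologicalSpace X] :
    ChainComplex (ModuleCat ℚ) ℕ :=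
  (alternatingFaceMapComplex (ModuleCat ℚ)).obj
    (TopCat.toSSet.obj (TopCat.of X) ⋙ ModuleCat.free ℚ)

/-- `n`-th rational singular homology of a topological space. -/
noncomputable def singularHomology (X : Type) [TopologicalSpace X] (n : ℕ) : ModuleCat ℚ :=
  (singularChains X).homology n

/-- Euler characteristic: the alternating sum of the ranks of the rational singular
homology groups. -/
noncomputable def eulerChar (X : Type) [TopologicalSpace X] : ℤ :=
  ∑ᶠ n : ℕ, (-1 : ℤ) ^ n * (Module.finrank ℚ (singularHomology X n) : ℤ)

/-- A Brouwer degree theory: an integer-valued degree for continuous maps on bounded open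
subsets of finite-dimensional real normed spaces, satisfying the standard axioms of
normalization, additivity (excision) and homotopy invariance, which characterize the
Brouwer degree uniquely. -/
structure DegreeTheory where
  /-- the degree `deg f A y` -/
  deg : ∀ (E : Type) [NormedAddCommGroup E] [NormedSpace ℝ E] [FiniteDimensional ℝ E],
    (E → E) → Set E → E → ℤ
  /-- normalization: the identity has degree one at interior points -/
  normalization : ∀ (E : Type) [NormedAddCommGroup E] [NormedSpace ℝ E]
    [FiniteDimensional ℝ E] (A : Set E) (y : E), IsOpen A → Bornology.IsBounded A →
    y ∈ A → deg E id A y = 1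
  /-- additivity with excision -/
  additivity : ∀ (E : Type) [NormedAddCommGroup E] [NormedSpace ℝ E]
    [FiniteDimensional ℝ E] (f : E → E) (A A₁ A₂ : Set E) (y : E),
    IsOpen A → Bornology.IsBounded A → IsOpen A₁ → IsOpen A₂ → A₁ ⊆ A → A₂ ⊆ A →
    Disjoint A₁ A₂ → ContinuousOn f (closure A) →
    (∀ x ∈ closure A \ (A₁ ∪ A₂), f x ≠ y) →
    deg E f A y = deg E f A₁ y + deg E f A₂ y
  /-- homotopy invariance -/
  homotopyInvariance : ∀ (E : Type) [NormedAddCommGroup E] [NormedSpace ℝ E]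
    [FiniteDimensional ℝ E] (H : ℝ → E → E) (A : Set E) (y : E),
    IsOpen A → Bornology.IsBounded A →
    ContinuousOn (fun p : ℝ × E => H p.1 p.2) (Set.Icc (0:ℝ) 1 ×ˢ closure A) →
    (∀ t ∈ Set.Icc (0:ℝ) 1, ∀ x ∈ frontier A, H t x ≠ y) →
    deg E (H 0) A y = deg E (H 1) A y

section Homology

open Limits
open scoped Simplicial

/-- The functor sending a space to its rational singular chain complex. -/
noncomputable def singularChainsFunctor : TopCat.{0} ⥤ ChainComplex (ModuleCat ℚ) ℕ :=
  TopCat.toSSet ⋙ (SimplicialObject.whiskering _ _).obj (ModuleCat.free ℚ) ⋙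
    alternatingFaceMapComplex (ModuleCat ℚ)

/-- A homotopy of maps induces a chain homotopy of singular chains. -/
noncomputable def singularChainsMapHomotopy {X Y : TopCat.{0}} {f g : X ⟶ Y}
    (H : TopCat.Homotopy f g) :
    Homotopy (singularChainsFunctor.map f) (singularChainsFunctor.map g) :=
  (H.toSSet.toSimplicialObjectHomotopy.whiskerRight (ModuleCat.free ℚ)).toChainHomotopy

open ContinuousMap in
noncomputable def singularChainsFunctor_homotopyEquiv {X Y : TopCat.{0}}
    (e : X ≃ₕ Y) : HomotopyEquiv (singularChainsFunctor.obj X) (singularChainsFunctor.obj Y) where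
  hom := singularChainsFunctor.map (TopCat.ofHom e.toFun)
  inv := singularChainsFunctor.map (TopCat.ofHom e.invFun)
  homotopyHomInvId :=
    (Homotopy.ofEq (singularChainsFunctor.map_comp _ _).symm).trans
      ((singularChainsMapHomotopy e.left_inv.some).trans
        (Homotopy.ofEq (singularChainsFunctor.map_id _)))
  homotopyInvHomId := 
    (Homotopy.ofEq (singularChainsFunctor.map_comp _ _).symm).trans
      ((singularChainsMapHomotopy e.right_inv.some).trans
        (Homotopy.ofEq (singularChainsFunctor.map_id _)))

/-- The singular chain complex of a point. -/
noncomputable def singularChainsPoint :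
    singularChainsFunctor.obj (TopCat.of Unit) ≅
      ChainComplex.alternatingConst.obj ((ModuleCat.free ℚ).obj Unit) :=
  (alternatingFaceMapComplex _).mapIso
    (((SimplicialObject.whiskering _ _).obj _).mapIso
    (TopCat.toSSetIsoConst (TopCat.of Unit)) ≪≫ Functor.constComp _ _ _) ≪≫
    alternatingFaceMapComplexConst.app _

/-- The singular homology of a contractible space is that of a point. -/
noncomputable def singularHomologyContractible (X : Type) [TopologicalSpace X]
    [ContractibleSpace X] (n : ℕ) :
    singularHomology X n ≅
      (ChainComplex.alternatingConst.obj ((ModuleCat.free ℚ).obj Unit)).homology n :=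
  (singularChainsFunctor_homotopyEquiv (X := TopCat.of X) (Y := TopCat.of Unit)
    (ContractibleSpace.hequiv_unit X).some).toHomologyIso n ≪≫
    (HomologicalComplex.homologyFunctor _ _ n).mapIso singularChainsPoint

/-- A chain complex of rational vector spaces has finite homology if its total homology is
finite-dimensional. -/
def HasFiniteHomology (C : ChainComplex (ModuleCat.{0} ℚ) ℕ) : Prop :=
  (∀ n, Module.Finite ℚ (C.homology n)) ∧ ∃ N, ∀ n, N ≤ n → Module.finrank ℚ (C.homology n) = 0

theorem hasFiniteHomology_and_eulerChar_of_contractible (X : Type) [TopologicalSpace X]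
    [ContractibleSpace X] : HasFiniteHomology (singularChains X) ∧ eulerChar X = 1 := by
  have h0 : singularHomology X 0 ≅ (ModuleCat.free ℚ).obj Unit :=
    singularHomologyContractible X 0 ≪≫ ChainComplex.alternatingConstHomologyZero _
  have h1 : ∀ n, n ≠ 0 → IsZero (singularHomology X n) := fun n hn =>
    (ChainComplex.alternatingConst_exactAt _ n hn).isZero_homology.of_iso
      (singularHomologyContractible X n)
  have h1' : ∀ n, n ≠ 0 → Subsingleton (singularHomology X n) := fun n hn =>
    ModuleCat.subsingleton_of_isZero (h1 n hn)
  have h1'' : ∀ n, n ≠ 0 → Module.finrank ℚ (singularHomology X n) = 0 := fun n hn => by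
    have := h1' n hn
    exact Module.finrank_zero_of_subsingleton
  let e : singularHomology X 0 ≃ₗ[ℚ] (Unit →₀ ℚ) := h0.toLinearEquiv
  have e1 : Module.finrank ℚ (singularHomology X 0) = 1 := by
    rw [e.finrank_eq]; simp
  refine ⟨⟨fun n => ?_, 1, fun n hn => h1'' n (by omega)⟩, ?_⟩
  · rcases eq_or_ne n 0 with rfl | hn
    · exact Module.Finite.equiv e.symm
    · have := h1' n hn
      change Module.Finite ℚ (singularHomology X n)
      infer_instance
  · rw [eulerChar, finsum_eq_single _ 0 (fun n hn => by simp [h1'' n hn])]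
    simp [e1]

theorem hasFiniteHomology_and_eulerChar_of_isEmpty (X : Type) [TopologicalSpace X]
    [IsEmpty X] : HasFiniteHomology (singularChains X) ∧ eulerChar X = 0 := by
  have h1 : ∀ n, IsZero (singularHomology X n) := fun n => by
    apply ShortComplex.isZero_homology_of_isZero_X₂
    have : IsEmpty ((TopCat.toSSet.obj (TopCat.of X)).obj (Opposite.op ⦋n⦌)) :=
      ⟨fun s => isEmptyElim ((TopCat.toSSetObjEquiv _ _ s)
        (Classical.arbitrary _) : X)⟩
    let M : ModuleCat ℚ := (ModuleCat.free ℚ).obj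
      ((TopCat.toSSet.obj (TopCat.of X)).obj (Opposite.op ⦋n⦌))
    have : Subsingleton M :=
      inferInstanceAs (Subsingleton
        (((TopCat.toSSet.obj (TopCat.of X)).obj (Opposite.op ⦋n⦌)) →₀ ℚ))
    exact ModuleCat.isZero_of_subsingleton M
  have h1' : ∀ n, Subsingleton (singularHomology X n) := fun n =>
    ModuleCat.subsingleton_of_isZero (h1 n)
  have h1'' : ∀ n, Module.finrank ℚ (singularHomology X n) = 0 := fun n => by
    have := h1' n
    exact Module.finrank_zero_of_subsingleton
  refine ⟨⟨fun n => ?_, 0, fun n hn => h1'' n⟩, ?_⟩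
  · have := h1' n
    change Module.Finite ℚ (singularHomology X n)
    infer_instance
  · simp [eulerChar, h1'']

section LongExact

variable {A B C : ℕ → Type} [∀ n, AddCommGroup (A n)] [∀ n, Module ℚ (A n)]
  [∀ n, AddCommGroup (B n)] [∀ n, Module ℚ (B n)] [∀ n, AddCommGroup (C n)] [∀ n, Module ℚ (C n)]

theorem Function.Exact.finite_of_finite {A B C : Type} [AddCommGroup A] [Module ℚ A]
    [AddCommGroup B]
    [Module ℚ B] [AddCommGroup C] [Module ℚ C] {f : A →ₗ[ℚ] B} {g : B →ₗ[ℚ] C}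
    (h : Function.Exact f g) [Module.Finite ℚ A] [Module.Finite ℚ C] : Module.Finite ℚ B := by
  have := isNoetherian_of_range_eq_ker f g (LinearMap.exact_iff.1 h).symm
  infer_instance

theorem Function.Exact.finrank_eq {A B C : Type} [AddCommGroup A] [Module ℚ A] [AddCommGroup B]
    [Module ℚ B] [AddCommGroup C] [Module ℚ C] {f : A →ₗ[ℚ] B} {g : B →ₗ[ℚ] C}
    (h : Function.Exact f g) [Module.Finite ℚ B] :
    Module.finrank ℚ B = Module.finrank ℚ f.range + Module.finrank ℚ g.range := by
  rw [← g.finrank_range_add_finrank_ker, LinearMap.exact_iff.1 h, add_comm]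

theorem sum_finrank_of_longExact (f : ∀ n, A n →ₗ[ℚ] B n) (g : ∀ n, B n →ₗ[ℚ] C n)
    (d : ∀ n, C (n + 1) →ₗ[ℚ] A n) (hf : ∀ n, Function.Exact (d n) (f n))
    (hg : ∀ n, Function.Exact (f n) (g n)) (hd : ∀ n, Function.Exact (g (n + 1)) (d n))
    (h0 : Function.Surjective (g 0)) [∀ n, Module.Finite ℚ (A n)] [∀ n, Module.Finite ℚ (B n)]
    [∀ n, Module.Finite ℚ (C n)] (N : ℕ) :
    ∑ n ∈ Finset.range (N + 1), (-1 : ℤ) ^ n * (Module.finrank ℚ (B n) : ℤ) =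
      ∑ n ∈ Finset.range (N + 1), (-1 : ℤ) ^ n * (Module.finrank ℚ (A n) : ℤ) +
      ∑ n ∈ Finset.range (N + 1), (-1 : ℤ) ^ n * (Module.finrank ℚ (C n) : ℤ) -
      (-1) ^ N * (Module.finrank ℚ (d N).range : ℤ) := by
  have hB := fun n => (hg n).finrank_eq
  have hA := fun n => (hf n).finrank_eq
  have hC := fun n => (hd n).finrank_eq
  induction N with
  | zero =>
    have : Module.finrank ℚ (g 0).range = Module.finrank ℚ (C 0) := by
      rw [LinearMap.range_eq_top.2 h0, finrank_top]
    simp only [zero_add, Finset.sum_range_one, pow_zero, one_mul]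
    have := hB 0; have := hA 0
    lia
  | succ N ih =>
    rw [Finset.sum_range_succ, ih, Finset.sum_range_succ _ (N + 1),
      Finset.sum_range_succ _ (N + 1), hB, hA (N + 1), hC N]
    push_cast
    ring

end LongExact

theorem sum_finrank_eq_finsum {a : ℕ → ℕ} {N M : ℕ} (h : ∀ n, N ≤ n → a n = 0) (hM : N ≤ M) :
    ∑ᶠ n : ℕ, (-1 : ℤ) ^ n * (a n : ℤ) = ∑ n ∈ Finset.range M, (-1 : ℤ) ^ n * (a n : ℤ) := by
  apply finsum_eq_sum_of_support_subset
  intro n hn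
  simp only [Finset.coe_range, Set.mem_Iio]
  by_contra hc
  exact hn (by simp [h n (by omega)])

/-- The alternating sum of the Betti numbers of a chain complex. -/
noncomputable def ChainComplex.eulerCharHomology (C : ChainComplex (ModuleCat.{0} ℚ) ℕ) : ℤ :=
  ∑ᶠ n : ℕ, (-1 : ℤ) ^ n * (Module.finrank ℚ (C.homology n) : ℤ)

namespace CategoryTheory.ShortComplex.ShortExact

variable {S : ShortComplex (ChainComplex (ModuleCat.{0} ℚ) ℕ)} (hS : S.ShortExact)

include hS

theorem homology_longExact :
    ∃ d : ∀ n, S.X₃.homology (n + 1) →ₗ[ℚ] S.X₁.homology n,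
    (∀ n, Function.Exact (d n) (HomologicalComplex.homologyMap S.f n).hom) ∧
    (∀ n, Function.Exact (HomologicalComplex.homologyMap S.f n).hom
      (HomologicalComplex.homologyMap S.g n).hom) ∧
    (∀ n, Function.Exact (HomologicalComplex.homologyMap S.g (n + 1)).hom (d n)) ∧
    Function.Surjective (HomologicalComplex.homologyMap S.g 0).hom := by
  refine ⟨fun n => (hS.δ (n + 1) n rfl).hom, fun n => ?_, fun n => ?_, fun n => ?_, ?_⟩
  · exact (ShortComplex.ShortExact.moduleCat_exact_iff_function_exact _).1
      (hS.homology_exact₁ (n + 1) n rfl)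
  · exact (ShortComplex.ShortExact.moduleCat_exact_iff_function_exact _).1
      (hS.homology_exact₂ n)
  · exact (ShortComplex.ShortExact.moduleCat_exact_iff_function_exact _).1
      (hS.homology_exact₃ (n + 1) n rfl)
  · have := hS.epi_g
    have := HomologicalComplex.epi_homologyMap_of_epi_of_not_rel S.g 0
      (fun j => by simp)
    exact (ModuleCat.epi_iff_surjective _).1 this

theorem hasFiniteHomology_X₂ (h₁ : HasFiniteHomology S.X₁) (h₃ : HasFiniteHomology S.X₃) :
    HasFiniteHomology S.X₂ := by
  obtain ⟨d, -, hg, -, -⟩ := hS.homology_longExact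
  have := h₁.1; have := h₃.1
  have hfin : ∀ n, Module.Finite ℚ (S.X₂.homology n) := fun n => (hg n).finite_of_finite
  refine ⟨hfin, ?_⟩
  obtain ⟨N₁, hN₁⟩ := h₁.2
  obtain ⟨N₃, hN₃⟩ := h₃.2
  refine ⟨max N₁ N₃, fun n hn => ?_⟩
  have e := (hg n).finrank_eq
  have h1 := LinearMap.finrank_range_le (HomologicalComplex.homologyMap S.f n).hom
  have h2 := Submodule.finrank_le (HomologicalComplex.homologyMap S.g n).hom.range
  have := hN₁ n (le_trans (le_max_left _ _) hn)
  have := hN₃ n (le_trans (le_max_right _ _) hn)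
  omega

theorem hasFiniteHomology_X₃ (h₁ : HasFiniteHomology S.X₁) (h₂ : HasFiniteHomology S.X₂) :
    HasFiniteHomology S.X₃ := by
  obtain ⟨d, -, -, hd, hs⟩ := hS.homology_longExact
  have := h₁.1; have := h₂.1
  have hfin : ∀ n, Module.Finite ℚ (S.X₃.homology n) := fun n => by
    cases n with
    | zero => exact Module.Finite.of_surjective _ hs
    | succ n => exact (hd n).finite_of_finite
  refine ⟨hfin, ?_⟩
  obtain ⟨N₁, hN₁⟩ := h₁.2
  obtain ⟨N₂, hN₂⟩ := h₂.2
  refine ⟨max N₁ N₂ + 1, fun n hn => ?_⟩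
  obtain ⟨n, rfl⟩ : ∃ m, n = m + 1 := ⟨n - 1, by omega⟩
  have e := (hd n).finrank_eq
  have h1 := LinearMap.finrank_range_le (HomologicalComplex.homologyMap S.g (n + 1)).hom
  have h2 := Submodule.finrank_le (d n).range
  have := hN₁ n (le_trans (le_max_left _ N₂) (by omega))
  have := hN₂ (n + 1) (le_trans (le_max_right N₁ _) (by omega))
  omega

theorem eulerCharHomology_add (h₁ : HasFiniteHomology S.X₁) (h₂ : HasFiniteHomology S.X₂)
    (h₃ : HasFiniteHomology S.X₃) :
    S.X₂.eulerCharHomology = S.X₁.eulerCharHomology + S.X₃.eulerCharHomology := by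
  obtain ⟨d, hf, hg, hd, hs⟩ := hS.homology_longExact
  have := h₁.1; have := h₂.1; have := h₃.1
  obtain ⟨N₁, hN₁⟩ := h₁.2
  obtain ⟨N₂, hN₂⟩ := h₂.2
  obtain ⟨N₃, hN₃⟩ := h₃.2
  have key := sum_finrank_of_longExact _ _ d hf hg hd hs (N₁ + N₂ + N₃)
  have h2 := Submodule.finrank_le (d (N₁ + N₂ + N₃)).range
  rw [hN₁ _ (by omega), Nat.le_zero] at h2
  rw [ChainComplex.eulerCharHomology, ChainComplex.eulerCharHomology,
    ChainComplex.eulerCharHomology, sum_finrank_eq_finsum hN₁ (M := N₁ + N₂ + N₃ + 1) (by omega),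
    sum_finrank_eq_finsum hN₂ (M := N₁ + N₂ + N₃ + 1) (by omega),
    sum_finrank_eq_finsum hN₃ (M := N₁ + N₂ + N₃ + 1) (by omega), key, h2]
  simp

end CategoryTheory.ShortComplex.ShortExact

theorem HasFiniteHomology.biprod {K L : ChainComplex (ModuleCat.{0} ℚ) ℕ}
    (hK : HasFiniteHomology K) (hL : HasFiniteHomology L) :
    HasFiniteHomology (K ⊞ L) ∧
      (K ⊞ L).eulerCharHomology = K.eulerCharHomology + L.eulerCharHomology := by
  have h := (ShortComplex.Splitting.ofHasBinaryBiproduct K L).shortExact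
  have h2 := h.hasFiniteHomology_X₂ hK hL
  exact ⟨h2, h.eulerCharHomology_add hK h2 hL⟩

theorem hasFiniteHomology_of_exactAt {Q : ChainComplex (ModuleCat.{0} ℚ) ℕ}
    (h : ∀ n, Q.ExactAt n) : HasFiniteHomology Q ∧ Q.eulerCharHomology = 0 := by
  have h1' : ∀ n, Subsingleton (Q.homology n) := fun n =>
    ModuleCat.subsingleton_of_isZero (h n).isZero_homology
  have h1'' : ∀ n, Module.finrank ℚ (Q.homology n) = 0 := fun n => by
    have := h1' n
    exact Module.finrank_zero_of_subsingleton
  refine ⟨⟨fun n => ?_, 0, fun n hn => h1'' n⟩, ?_⟩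
  · have := h1' n
    infer_instance
  · simp [ChainComplex.eulerCharHomology, h1'']

theorem hasFiniteHomology_of_exact_of_coker {A B C : ChainComplex (ModuleCat.{0} ℚ) ℕ}
    {φ : A ⟶ B} {ψ : B ⟶ C} (w : φ ≫ ψ = 0) [Mono φ] (hex : (ShortComplex.mk φ ψ w).Exact)
    (hQ : ∀ n, (cokernel ψ).ExactAt n) (hA : HasFiniteHomology A) (hB : HasFiniteHomology B) :
    HasFiniteHomology C ∧ B.eulerCharHomology = A.eulerCharHomology + C.eulerCharHomology := by
  have w1 : φ ≫ factorThruImage ψ = 0 := by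
    rw [← cancel_mono (image.ι ψ)]; simpa using w
  have w2 : image.ι ψ ≫ cokernel.π ψ = 0 := by
    rw [← cancel_epi (factorThruImage ψ)]; simp
  have e1 : (ShortComplex.mk φ (factorThruImage ψ) w1).ShortExact := by
    let τ : ShortComplex.mk φ (factorThruImage ψ) w1 ⟶ ShortComplex.mk φ ψ w :=
      { τ₁ := 𝟙 _, τ₂ := 𝟙 _, τ₃ := image.ι ψ }
    have : Epi τ.τ₁ := inferInstanceAs (Epi (𝟙 _))
    have : IsIso τ.τ₂ := inferInstanceAs (IsIso (𝟙 _))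
    have : Mono τ.τ₃ := inferInstanceAs (Mono (image.ι ψ))
    exact { exact := (ShortComplex.exact_iff_of_epi_of_isIso_of_mono τ).2 hex
            mono_f := ‹_›
            epi_g := inferInstanceAs (Epi (factorThruImage ψ)) }
  have e2 : (ShortComplex.mk (image.ι ψ) (cokernel.π ψ) w2).ShortExact := by
    let τ : ShortComplex.mk ψ (cokernel.π ψ) (cokernel.condition ψ) ⟶
        ShortComplex.mk (image.ι ψ) (cokernel.π ψ) w2 :=
      { τ₁ := factorThruImage ψ, τ₂ := 𝟙 _, τ₃ := 𝟙 _ }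
    have : Epi τ.τ₁ := inferInstanceAs (Epi (factorThruImage ψ))
    have : IsIso τ.τ₂ := inferInstanceAs (IsIso (𝟙 _))
    have : Mono τ.τ₃ := inferInstanceAs (Mono (𝟙 _))
    exact { exact := (ShortComplex.exact_iff_of_epi_of_isIso_of_mono τ).1
              (ShortComplex.exact_cokernel ψ)
            mono_f := inferInstanceAs (Mono (image.ι ψ))
            epi_g := inferInstanceAs (Epi (cokernel.π ψ)) }
  have hI := e1.hasFiniteHomology_X₃ hA hB
  obtain ⟨hQf, hQχ⟩ := hasFiniteHomology_of_exactAt hQ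
  have hC := e2.hasFiniteHomology_X₂ hI hQf
  refine ⟨hC, ?_⟩
  have x1 := e1.eulerCharHomology_add hA hB hI
  have x2 := e2.eulerCharHomology_add hI hC hQf
  simp only at x1 x2
  rw [x1, x2, hQχ, add_zero]

theorem exactAt_cokernel {B C : ChainComplex (ModuleCat.{0} ℚ) ℕ} (ψ : B ⟶ C) (n : ℕ)
    (h : ∀ m : C.X n, C.d n (n - 1) m ∈ (ψ.f (n - 1)).hom.range →
      ∃ w : C.X (n + 1), m - C.d (n + 1) n w ∈ (ψ.f n).hom.range) :
    (cokernel ψ).ExactAt n := by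
  have hex : ∀ k, Function.Exact (ψ.f k).hom ((cokernel.π ψ).f k).hom := fun k => by
    have := (ShortComplex.exact_cokernel ψ).map (HomologicalComplex.eval _ _ k)
    exact (ShortComplex.ShortExact.moduleCat_exact_iff_function_exact _).1 this
  have hsurj : ∀ k, Function.Surjective ((cokernel.π ψ).f k).hom := fun k => by
    have : Epi ((cokernel.π ψ).f k) := inferInstance
    exact (ModuleCat.epi_iff_surjective _).1 this
  rw [HomologicalComplex.exactAt_iff' _ (n + 1) n (n - 1) (by simp) (by cases n <;> simp),
    ShortComplex.moduleCat_exact_iff]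
  intro q hq
  obtain ⟨m, rfl⟩ := hsurj n q
  have comm : ∀ i j (x : C.X i), ((cokernel.π ψ).f j).hom ((C.d i j) x) =
      ((cokernel ψ).d i j) (((cokernel.π ψ).f i).hom x) := fun i j x => by
    have := (cokernel.π ψ).comm i j
    exact (congr($(this) x)).symm
  have h1 : ((cokernel.π ψ).f (n - 1)).hom ((C.d n (n - 1)) m) = 0 := by
    rw [comm]; exact hq
  obtain ⟨w, hw⟩ := h m ((hex (n - 1) _).1 h1)
  refine ⟨((cokernel.π ψ).f (n + 1)).hom w, ?_⟩
  change ((cokernel ψ).d (n + 1) n) _ = _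
  rw [← comm]
  have := (hex n _).2 hw
  rw [map_sub, sub_eq_zero] at this
  exact this.symm

/-- **Mayer–Vietoris** for Euler characteristics, from a square of chain complexes. -/
theorem eulerCharHomology_mayerVietoris {P K L M : ChainComplex (ModuleCat.{0} ℚ) ℕ}
    (a : P ⟶ K) (b : P ⟶ L) (c : K ⟶ M) (d : L ⟶ M) (hcomm : a ≫ c = b ≫ d)
    (ha : ∀ n, Function.Injective (a.f n).hom)
    (hex : ∀ n (x : K.X n) (y : L.X n), (c.f n).hom x = (d.f n).hom y →
      ∃ p, (a.f n).hom p = x ∧ (b.f n).hom p = y)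
    (hsmall : ∀ n (m : M.X n), M.d n (n - 1) m ∈ (c.f (n - 1)).hom.range ⊔ (d.f (n - 1)).hom.range →
      ∃ w : M.X (n + 1), m - M.d (n + 1) n w ∈ (c.f n).hom.range ⊔ (d.f n).hom.range)
    (hP : HasFiniteHomology P) (hK : HasFiniteHomology K) (hL : HasFiniteHomology L) :
    HasFiniteHomology M ∧ M.eulerCharHomology + P.eulerCharHomology =
      K.eulerCharHomology + L.eulerCharHomology := by
  obtain ⟨hB, hχ⟩ := hK.biprod hL
  have w : biprod.lift a b ≫ biprod.desc c (-d) = 0 := by simp [hcomm]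
  have hf1 : ∀ n p, ((biprod.fst : K ⊞ L ⟶ K).f n).hom (((biprod.lift a b).f n).hom p) =
      (a.f n).hom p := fun n p => by
    have : biprod.lift a b ≫ biprod.fst = a := by simp
    exact congr((HomologicalComplex.Hom.f $this n).hom p)
  have hf2 : ∀ n p, ((biprod.snd : K ⊞ L ⟶ L).f n).hom (((biprod.lift a b).f n).hom p) =
      (b.f n).hom p := fun n p => by
    have : biprod.lift a b ≫ biprod.snd = b := by simp
    exact congr((HomologicalComplex.Hom.f $this n).hom p)
  have htot : ∀ n (z : (K ⊞ L).X n),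
      ((biprod.inl : K ⟶ K ⊞ L).f n).hom (((biprod.fst : K ⊞ L ⟶ K).f n).hom z) +
      ((biprod.inr : L ⟶ K ⊞ L).f n).hom (((biprod.snd : K ⊞ L ⟶ L).f n).hom z) = z :=
    fun n z => by
    have : (biprod.fst ≫ biprod.inl + biprod.snd ≫ biprod.inr : K ⊞ L ⟶ K ⊞ L) = 𝟙 _ :=
      biprod.total
    exact congr((HomologicalComplex.Hom.f $this n).hom z)
  have hd1 : ∀ n x, ((biprod.desc c (-d)).f n).hom (((biprod.inl : K ⟶ K ⊞ L).f n).hom x) =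
      (c.f n).hom x := fun n x => by
    have : biprod.inl ≫ biprod.desc c (-d) = c := by simp
    exact congr((HomologicalComplex.Hom.f $this n).hom x)
  have hd2 : ∀ n x, ((biprod.desc c (-d)).f n).hom (((biprod.inr : L ⟶ K ⊞ L).f n).hom x) =
      -(d.f n).hom x := fun n x => by
    have : biprod.inr ≫ biprod.desc c (-d) = -d := by simp
    exact congr((HomologicalComplex.Hom.f $this n).hom x)
  have hrange : ∀ n, ((biprod.desc c (-d)).f n).hom.range =
      (c.f n).hom.range ⊔ (d.f n).hom.range := fun n => by
    apply le_antisymm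
    · rintro _ ⟨z, rfl⟩
      rw [← htot n z, map_add, hd1, hd2]
      exact Submodule.add_mem_sup ⟨_, rfl⟩ (Submodule.neg_mem _ ⟨_, rfl⟩)
    · refine sup_le ?_ ?_
      · rintro _ ⟨x, rfl⟩
        exact ⟨_, hd1 n x⟩
      · rintro _ ⟨x, rfl⟩
        refine ⟨-((biprod.inr : L ⟶ K ⊞ L).f n).hom x, ?_⟩
        rw [map_neg, hd2, neg_neg]
  have hmono : Mono (biprod.lift a b) := by
    have : ∀ n, Mono ((biprod.lift a b).f n) := fun n => by
      rw [ModuleCat.mono_iff_injective]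
      intro x y hxy
      apply ha n
      rw [← hf1, ← hf1]
      exact congrArg _ hxy
    exact HomologicalComplex.mono_of_mono_f _ this
  have hexact : (ShortComplex.mk _ _ w).Exact := by
    apply HomologicalComplex.exact_of_degreewise_exact
    intro n
    rw [ShortComplex.moduleCat_exact_iff]
    intro z hz
    change ((biprod.desc c (-d)).f n).hom z = 0 at hz
    change ∃ x, ((biprod.lift a b).f n).hom x = z
    rw [← htot n z, map_add, hd1, hd2, ← sub_eq_add_neg, sub_eq_zero] at hz
    obtain ⟨p, hp1, hp2⟩ := hex n _ _ hz
    refine ⟨p, ?_⟩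
    rw [← htot n (((biprod.lift a b).f n).hom p), ← htot n z, hf1, hf2, hp1, hp2]
  obtain ⟨h1, h2⟩ := hasFiniteHomology_of_exact_of_coker w hexact
    (fun n => exactAt_cokernel _ n (by simpa only [hrange] using hsmall n)) hP hB
  exact ⟨h1, by rw [← hχ, h2, add_comm]⟩

end Homology

section Subdivision

open Limits

/-- Rational chains of ordered `(m + 1)`-tuples of elements of `K`. -/
abbrev TupleChains (K : Type) (m : ℕ) : Type := (Fin (m + 1) → K) →₀ ℚ

namespace TupleChains

variable {K K' : Type}

/-- The alternating sum of the faces of a tuple, extended linearly. -/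
noncomputable def boundary (K : Type) (m : ℕ) : TupleChains K (m + 1) →ₗ[ℚ] TupleChains K m :=
  Finsupp.linearCombination ℚ fun v =>
    ∑ i : Fin (m + 2), (-1 : ℚ) ^ (i : ℕ) • Finsupp.single (v ∘ i.succAbove) (1 : ℚ)

theorem boundary_single {m : ℕ} (v : Fin (m + 2) → K) :
    boundary K m (Finsupp.single v 1) =
      ∑ i : Fin (m + 2), (-1 : ℚ) ^ (i : ℕ) • Finsupp.single (v ∘ i.succAbove) (1 : ℚ) := by
  simp [boundary]

/-- The map of tuple chains induced by a map of vertices. -/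
noncomputable def map (g : K → K') (m : ℕ) : TupleChains K m →ₗ[ℚ] TupleChains K' m :=
  Finsupp.lmapDomain ℚ ℚ (g ∘ ·)

@[simp]
theorem map_single (g : K → K') {m : ℕ} (v : Fin (m + 1) → K) (a : ℚ) :
    map g m (Finsupp.single v a) = Finsupp.single (g ∘ v) a := by
  simp [map]

theorem boundary_map (g : K → K') (m : ℕ) (c : TupleChains K (m + 1)) :
    boundary K' m (map g (m + 1) c) = map g m (boundary K m c) := by
  induction c using Finsupp.induction_linear with
  | zero => simp
  | add x y hx hy => simp only [map_add, hx, hy]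
  | single v a =>
    rw [← mul_one a, ← smul_eq_mul, ← Finsupp.smul_single]
    simp only [map_smul, map_single, boundary_single, map_sum]
    rfl

/-- The cone on a tuple chain. -/
noncomputable def cone (p : K) (m : ℕ) : TupleChains K m →ₗ[ℚ] TupleChains K (m + 1) :=
  Finsupp.lmapDomain ℚ ℚ fun v : Fin (m + 1) → K => (Fin.cons p v : Fin (m + 2) → K)

@[simp]
theorem cone_single (p : K) {m : ℕ} (v : Fin (m + 1) → K) (a : ℚ) :
    cone p m (Finsupp.single v a) =
      Finsupp.single (Fin.cons p v : Fin (m + 2) → K) a := by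
  simp [cone]

theorem map_cone (g : K → K') (p : K) (m : ℕ) (c : TupleChains K m) :
    map g (m + 1) (cone p m c) = cone (g p) m (map g m c) := by
  induction c using Finsupp.induction_linear with
  | zero => simp
  | add x y hx hy => simp only [map_add, hx, hy]
  | single v a =>
    simp only [cone_single, map_single]
    congr 1
    funext i
    refine Fin.cases ?_ (fun i => ?_) i <;> simp

theorem boundary_cone_single (p : K) {m : ℕ} (v : Fin (m + 2) → K) :
    boundary K (m + 1) (Finsupp.single (Fin.cons p v : Fin (m + 3) → K) 1) =
      Finsupp.single v 1 - cone p m (boundary K m (Finsupp.single v 1)) := by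
  rw [boundary_single, Fin.sum_univ_succ, boundary_single, map_sum, sub_eq_add_neg,
    ← Finset.sum_neg_distrib]
  congr 1
  · simp only [Fin.val_zero, pow_zero, one_smul]
    congr 1
  · refine Finset.sum_congr rfl fun i _ => ?_
    rw [map_smul, cone_single, ← neg_smul, Fin.val_succ, pow_succ, mul_neg_one]
    congr 2
    funext j
    refine Fin.cases ?_ (fun j => ?_) j <;> simp

theorem boundary_cone (p : K) (m : ℕ) (c : TupleChains K (m + 1)) :
    boundary K (m + 1) (cone p (m + 1) c) = c - cone p m (boundary K m c) := by
  induction c using Finsupp.induction_linear with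
  | zero => simp
  | add x y hx hy => simp only [map_add, hx, hy]; abel
  | single v a =>
    rw [← mul_one a, ← smul_eq_mul, ← Finsupp.smul_single]
    simp only [map_smul]
    rw [cone_single, boundary_cone_single, smul_sub]

theorem boundary_boundary (m : ℕ) (c : TupleChains K (m + 2)) :
    boundary K m (boundary K (m + 1) c) = 0 := by
  induction m with
  | zero =>
    induction c using Finsupp.induction_linear with
    | zero => simp
    | add x y hx hy => simp only [map_add, hx, hy, add_zero]
    | single v a =>
      rw [← mul_one a, ← smul_eq_mul, ← Finsupp.smul_single, map_smul, map_smul]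
      have e (i : Fin 3) (j : Fin 2) : (v ∘ i.succAbove) ∘ j.succAbove =
        fun _ => v (i.succAbove (j.succAbove 0)) := by
        funext k; rw [Subsingleton.elim k 0]; rfl
      rw [boundary_single, Fin.sum_univ_three, map_add, map_add, map_smul, map_smul, map_smul,
        boundary_single, boundary_single, boundary_single, Fin.sum_univ_two, Fin.sum_univ_two,
        Fin.sum_univ_two]
      simp only [e]
      simp [Fin.succAbove]
      abel
  | succ m ih =>
    induction c using Finsupp.induction_linear with
    | zero => simp
    | add x y hx hy => simp only [map_add, hx, hy, add_zero]
    | single v a =>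
      rw [← mul_one a, ← smul_eq_mul, ← Finsupp.smul_single, map_smul, map_smul,
        ← Fin.cons_self_tail v, boundary_cone_single, map_sub, boundary_cone, ih]
      simp

variable (β : ∀ m, (Fin (m + 1) → K) → K) (β' : ∀ m, (Fin (m + 1) → K') → K')

/-- The chain homotopy between the identity and the subdivision of tuple chains obtained by
coning off at the points `β`. -/
noncomputable def homotopy : ∀ m, TupleChains K m →ₗ[ℚ] TupleChains K (m + 1)
  | 0 => 0
  | m + 1 => Finsupp.linearCombination ℚ fun v => cone (β (m + 1) v) (m + 1)
      (Finsupp.single v 1 - homotopy m (boundary K m (Finsupp.single v 1)))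

theorem homotopy_succ_single {m : ℕ} (v : Fin (m + 2) → K) :
    homotopy β (m + 1) (Finsupp.single v 1) = cone (β (m + 1) v) (m + 1)
      (Finsupp.single v 1 - homotopy β m (boundary K m (Finsupp.single v 1))) := by
  simp [homotopy]

variable {β β'} in
theorem map_homotopy {g : K → K'} (hg : ∀ m v, g (β m v) = β' m (g ∘ v)) (m : ℕ)
    (c : TupleChains K m) :
    map g (m + 1) (homotopy β m c) = homotopy β' m (map g m c) := by
  induction m with
  | zero => simp [homotopy]
  | succ m ih =>
    induction c using Finsupp.induction_linear with
    | zero => simp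
    | add x y hx hy => simp only [map_add, hx, hy]
    | single v a =>
      rw [← mul_one a, ← smul_eq_mul, ← Finsupp.smul_single]
      simp only [map_smul]
      rw [map_single, homotopy_succ_single, homotopy_succ_single, map_cone, hg, map_sub, ih,
        ← boundary_map, map_single]

/-- The subdivision operator attached to `TupleChains.homotopy`. -/
noncomputable def subdivision : ∀ m, TupleChains K m →ₗ[ℚ] TupleChains K m
  | 0 => LinearMap.id
  | m + 1 => LinearMap.id - boundary K (m + 1) ∘ₗ homotopy β (m + 1)
      - homotopy β m ∘ₗ boundary K m

theorem subdivision_succ (m : ℕ) (c : TupleChains K (m + 1)) :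
    subdivision β (m + 1) c = c - boundary K (m + 1) (homotopy β (m + 1) c)
      - homotopy β m (boundary K m c) := rfl

theorem subdivision_boundary (m : ℕ) (c : TupleChains K (m + 1)) :
    subdivision β m (boundary K m c) =
      boundary K m c - boundary K m (homotopy β m (boundary K m c)) := by
  cases m with
  | zero => simp [subdivision, homotopy]
  | succ m => rw [subdivision_succ, boundary_boundary, map_zero, sub_zero]

theorem subdivision_succ_single {m : ℕ} (v : Fin (m + 2) → K) :
    subdivision β (m + 1) (Finsupp.single v 1) = cone (β (m + 1) v) m
      (subdivision β m (boundary K m (Finsupp.single v 1))) := by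
  rw [subdivision_succ, homotopy_succ_single, boundary_cone, subdivision_boundary, map_sub]
  abel


theorem _root_.Finsupp.exists_mem_support_of_linearMap {α α' : Type} (L : (α →₀ ℚ) →ₗ[ℚ] (α' →₀ ℚ))
    (c : α →₀ ℚ) {w : α'} (hw : w ∈ (L c).support) :
    ∃ v ∈ c.support, w ∈ (L (Finsupp.single v 1)).support := by
  by_contra! h
  rw [Finsupp.mem_support_iff] at hw
  apply hw
  conv_lhs => rw [← Finsupp.sum_single c]
  rw [Finsupp.sum, map_sum, Finsupp.finsetSum_apply]
  refine Finset.sum_eq_zero fun v hv => ?_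
  have := Finsupp.notMem_support_iff.1 (h v hv)
  rw [← mul_one (c v), ← smul_eq_mul, ← Finsupp.smul_single, map_smul, Finsupp.smul_apply, this,
    smul_zero]

theorem exists_of_mem_support_boundary {m : ℕ} {v : Fin (m + 2) → K} {w : Fin (m + 1) → K}
    (hw : w ∈ (boundary K m (Finsupp.single v 1)).support) :
    ∃ i : Fin (m + 2), w = v ∘ i.succAbove := by
  by_contra! h
  rw [Finsupp.mem_support_iff] at hw
  apply hw
  rw [boundary_single, Finsupp.finsetSum_apply]
  refine Finset.sum_eq_zero fun i _ => ?_
  rw [Finsupp.smul_apply, Finsupp.single_eq_of_ne (h i), smul_zero]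

theorem exists_of_mem_support_cone {p : K} {m : ℕ} {c : TupleChains K m} {w : Fin (m + 2) → K}
    (hw : w ∈ (cone p m c).support) : ∃ u ∈ c.support, (Fin.cons p u : Fin (m + 2) → K) = w := by
  classical
  exact Finset.mem_image.1 (Finsupp.mapDomain_support hw)

section Diameter

variable {E : Type} [NormedAddCommGroup E] [NormedSpace ℝ E] {val : K → E} {β}
  (hβ : ∀ m v, val (β m v) = ((m : ℝ) + 1)⁻¹ • ∑ i, val (v i))
include hβ

theorem dist_barycenter_le {m : ℕ} (v : Fin (m + 1) → K) {p : E} {R : Fin (m + 1) → ℝ}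
    (h : ∀ i, dist (val (v i)) p ≤ R i) :
    dist (val (β m v)) p ≤ ((m : ℝ) + 1)⁻¹ * ∑ i, R i := by
  have hm : (0 : ℝ) < (m : ℝ) + 1 := by positivity
  have e : val (β m v) - p = ((m : ℝ) + 1)⁻¹ • ∑ i, (val (v i) - p) := by
    rw [hβ, Finset.sum_sub_distrib, smul_sub]
    simp only [Finset.sum_const, Finset.card_univ, Fintype.card_fin]
    rw [← Nat.cast_smul_eq_nsmul ℝ, smul_smul]
    push_cast
    rw [inv_mul_cancel₀ hm.ne', one_smul]
  rw [dist_eq_norm, e, norm_smul, Real.norm_of_nonneg (by positivity)]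
  gcongr
  refine (norm_sum_le _ _).trans (Finset.sum_le_sum fun i _ => ?_)
  rw [← dist_eq_norm]
  exact h i

theorem dist_le_of_mem_support_subdivision {m : ℕ} {v w : Fin (m + 1) → K}
    (hw : w ∈ (subdivision β m (Finsupp.single v 1)).support) {p : E} {R : ℝ}
    (h : ∀ i, dist (val (v i)) p ≤ R) (j : Fin (m + 1)) : dist (val (w j)) p ≤ R := by
  induction m with
  | zero =>
    have : w = v := by
      by_contra hne
      rw [subdivision, LinearMap.id_apply, Finsupp.mem_support_iff,
        Finsupp.single_eq_of_ne hne] at hw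
      exact hw rfl
    rw [this]
    exact h j
  | succ m ih =>
    rw [subdivision_succ_single] at hw
    obtain ⟨u, hu, hwu⟩ := exists_of_mem_support_cone hw
    obtain ⟨v', hv', hu'⟩ := Finsupp.exists_mem_support_of_linearMap _ _ hu
    obtain ⟨i, rfl⟩ := exists_of_mem_support_boundary hv'
    subst hwu
    refine Fin.cases ?_ (fun j => ?_) j
    · rw [Fin.cons_zero]
      refine (dist_barycenter_le hβ v h).trans (le_of_eq ?_)
      simp
      field_simp
    · rw [Fin.cons_succ]
      exact ih hu' (fun k => h _) j

theorem dist_le_mul_of_mem_support_subdivision {m : ℕ} {v w : Fin (m + 1) → K}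
    (hw : w ∈ (subdivision β m (Finsupp.single v 1)).support) {D : ℝ}
    (h : ∀ i j, dist (val (v i)) (val (v j)) ≤ D) (i j : Fin (m + 1)) :
    dist (val (w i)) (val (w j)) ≤ m / (m + 1) * D := by
  have hD : 0 ≤ D := dist_nonneg.trans (h 0 0)
  induction m with
  | zero =>
    rw [Fin.fin_one_eq_zero i, Fin.fin_one_eq_zero j]
    simp
  | succ m ih =>
    have hc : dist (val (β (m + 1) v)) (val (β (m + 1) v)) ≤
        ((m + 1 : ℕ) : ℝ) / ((m + 1 : ℕ) + 1) * D := by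
      rw [dist_self]; positivity
    rw [subdivision_succ_single] at hw
    obtain ⟨u, hu, hwu⟩ := exists_of_mem_support_cone hw
    obtain ⟨v', hv', hu'⟩ := Finsupp.exists_mem_support_of_linearMap _ _ hu
    obtain ⟨k, rfl⟩ := exists_of_mem_support_boundary hv'
    subst hwu
    have hv (l : Fin (m + 2)) : dist (val (v l)) (val (β (m + 1) v)) ≤
        ((m + 1 : ℕ) : ℝ) / ((m + 1 : ℕ) + 1) * D := by
      rw [dist_comm]
      refine (dist_barycenter_le hβ v (R := fun i => if i = l then 0 else D) fun i => ?_).trans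
        (le_of_eq ?_)
      · split_ifs with hi
        · rw [hi, dist_self]
        · exact h _ _
      · have e (i : Fin (m + 2)) : (if i = l then 0 else D) = D - if i = l then D else 0 := by
          split_ifs <;> simp
        simp only [e, Finset.sum_sub_distrib]
        simp
        field_simp
        ring
    have hb (j) : dist (val (u j)) (val (β (m + 1) v)) ≤
        ((m + 1 : ℕ) : ℝ) / ((m + 1 : ℕ) + 1) * D :=
      dist_le_of_mem_support_subdivision hβ hu' (fun l => hv _) j
    have hu2 (i j) := ih hu' (fun i j => h _ _) i j
    have hle : (m : ℝ) / (m + 1) * D ≤ ((m + 1 : ℕ) : ℝ) / ((m + 1 : ℕ) + 1) * D := by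
      gcongr ?_ * D
      rw [div_le_div_iff₀ (by positivity) (by positivity)]
      push_cast
      nlinarith
    refine Fin.cases ?_ (fun i => ?_) i <;> refine Fin.cases ?_ (fun j => ?_) j
    · exact hc
    · rw [dist_comm]; exact hb j
    · exact hb i
    · exact (hu2 i j).trans hle

theorem dist_le_pow_mul_of_mem_support_subdivision_pow {m : ℕ} {v w : Fin (m + 1) → K} {D : ℝ}
    (h : ∀ i j, dist (val (v i)) (val (v j)) ≤ D) (N : ℕ)
    (hw : w ∈ ((subdivision β m ^ N) (Finsupp.single v 1)).support) (i j : Fin (m + 1)) :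
    dist (val (w i)) (val (w j)) ≤ ((m : ℝ) / (m + 1)) ^ N * D := by
  induction N generalizing w i j with
  | zero =>
    have : w = v := by
      by_contra hne
      rw [pow_zero, Module.End.one_apply, Finsupp.mem_support_iff,
        Finsupp.single_eq_of_ne hne] at hw
      exact hw rfl
    rw [this, pow_zero, one_mul]
    exact h i j
  | succ N ih =>
    rw [pow_succ', Module.End.mul_apply] at hw
    obtain ⟨u, hu, hu'⟩ := Finsupp.exists_mem_support_of_linearMap _ _ hw
    rw [pow_succ', mul_assoc]
    exact dist_le_mul_of_mem_support_subdivision hβ hu' (fun i j => ih hu i j) i j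

end Diameter

end TupleChains

/-- The standard topological simplex. -/
abbrev TopSimplex (n : ℕ) : Type := stdSimplex ℝ (Fin (n + 1))

namespace TopSimplex

/-- The affine map of standard simplices with prescribed values at the vertices. -/
noncomputable def affineMap {k m : ℕ} (v : Fin (m + 1) → TopSimplex k) :
    C(TopSimplex m, TopSimplex k) where
  toFun t := ⟨∑ i, t i • (v i).1, (convex_stdSimplex ℝ _).sum_mem (fun i _ => t.2.1 i) t.2.2
    (fun i _ => (v i).2)⟩
  continuous_toFun := by
    have h (i : Fin (m + 1)) : Continuous fun t : TopSimplex m => t i :=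
      (continuous_apply i).comp (continuous_subtype_val (p := (· ∈ stdSimplex ℝ (Fin (m + 1)))))
    exact Continuous.subtype_mk
      (continuous_finsetSum _ fun i _ => (h i).smul continuous_const) _

theorem affineMap_coe {k m : ℕ} (v : Fin (m + 1) → TopSimplex k) (t : TopSimplex m) :
    (affineMap v t).1 = ∑ i, t i • (v i).1 := rfl

/-- The inclusion of a face. -/
noncomputable def face {n : ℕ} (i : Fin (n + 2)) : C(TopSimplex n, TopSimplex (n + 1)) :=
  ⟨stdSimplex.map i.succAbove, stdSimplex.continuous_map _⟩

theorem affineMap_comp_face {k m : ℕ} (v : Fin (m + 2) → TopSimplex k) (i : Fin (m + 2)) :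
    (affineMap v).comp (face i) = affineMap (v ∘ i.succAbove) := by
  ext1 t
  apply Subtype.ext
  change (affineMap v (stdSimplex.map i.succAbove t)).1 = _
  rw [affineMap_coe, affineMap_coe, stdSimplex.map_coe]
  simp only [FunOnFinite.linearMap_apply_apply, Finset.sum_smul]
  rw [← Finset.sum_fiberwise Finset.univ i.succAbove]
  refine Finset.sum_congr rfl fun j _ => Finset.sum_congr rfl fun l hl => ?_
  rw [Function.comp_apply, (Finset.mem_filter.1 hl).2]

theorem affineMap_comp {k l m : ℕ} (v : Fin (m + 1) → TopSimplex l)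
    (u : Fin (l + 1) → TopSimplex k) :
    (affineMap u).comp (affineMap v) = affineMap (affineMap u ∘ v) := by
  ext1 t
  apply Subtype.ext
  change (affineMap u (affineMap v t)).1 = _
  rw [affineMap_coe, affineMap_coe]
  change ∑ i, (affineMap v t).1 i • _ = ∑ i, t i • (affineMap u (v i)).1
  simp only [affineMap_coe, Finset.sum_apply, Finset.sum_smul, Finset.smul_sum]
  rw [Finset.sum_comm]
  refine Finset.sum_congr rfl fun j _ => Finset.sum_congr rfl fun l hl => ?_
  rw [smul_smul]
  rfl

theorem affineMap_vertex {k m : ℕ} (v : Fin (m + 1) → TopSimplex k) :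
    affineMap v ∘ stdSimplex.vertex = v := by
  funext i
  apply Subtype.ext
  change (affineMap v (stdSimplex.vertex i)).1 = _
  rw [affineMap_coe, stdSimplex.vertex_coe, Finset.sum_eq_single i]
  · simp
  · intro j _ hj; simp [hj]
  · simp

/-- The barycenter of a tuple of points of a simplex. -/
noncomputable def bary (k m : ℕ) (v : Fin (m + 1) → TopSimplex k) : TopSimplex k :=
  affineMap v stdSimplex.barycenter

theorem bary_coe (k m : ℕ) (v : Fin (m + 1) → TopSimplex k) :
    (bary k m v).1 = ((m : ℝ) + 1)⁻¹ • ∑ i, (v i).1 := by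
  rw [bary, affineMap_coe, Finset.smul_sum]
  refine Finset.sum_congr rfl fun i _ => ?_
  congr 1
  exact (stdSimplex.barycenter_apply i).trans (by simp)

theorem affineMap_bary {k l m : ℕ} (u : Fin (l + 1) → TopSimplex k)
    (v : Fin (m + 1) → TopSimplex l) :
    affineMap u (bary l m v) = bary k m (affineMap u ∘ v) := by
  rw [bary, bary, ← affineMap_comp]
  rfl

end TopSimplex

/-- Rational singular chains, as finitely supported functions on singular simplices. -/
abbrev SingChains (X : Type) [TopologicalSpace X] (n : ℕ) : Type := C(TopSimplex n, X) →₀ ℚ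

namespace SingChains

open TopSimplex

variable {X Y : Type} [TopologicalSpace X] [TopologicalSpace Y]

/-- The boundary of singular chains. -/
noncomputable def boundary (X : Type) [TopologicalSpace X] (n : ℕ) :
    SingChains X (n + 1) →ₗ[ℚ] SingChains X n :=
  Finsupp.linearCombination ℚ fun σ =>
    ∑ i : Fin (n + 2), (-1 : ℚ) ^ (i : ℕ) • Finsupp.single (σ.comp (face i)) (1 : ℚ)

theorem boundary_single {n : ℕ} (σ : C(TopSimplex (n + 1), X)) :
    boundary X n (Finsupp.single σ 1) =
      ∑ i : Fin (n + 2), (-1 : ℚ) ^ (i : ℕ) • Finsupp.single (σ.comp (face i)) (1 : ℚ) := by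
  simp [boundary]

/-- The map of singular chains induced by a continuous map. -/
noncomputable def map (g : C(X, Y)) (n : ℕ) : SingChains X n →ₗ[ℚ] SingChains Y n :=
  Finsupp.lmapDomain ℚ ℚ g.comp

@[simp]
theorem map_single (g : C(X, Y)) {n : ℕ} (σ : C(TopSimplex n, X)) (a : ℚ) :
    map g n (Finsupp.single σ a) = Finsupp.single (g.comp σ) a := by
  simp [map]

theorem boundary_map (g : C(X, Y)) (n : ℕ) (c : SingChains X (n + 1)) :
    boundary Y n (map g (n + 1) c) = map g n (boundary X n c) := by
  induction c using Finsupp.induction_linear with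
  | zero => simp
  | add x y hx hy => simp only [map_add, hx, hy]
  | single σ a =>
    rw [← mul_one a, ← smul_eq_mul, ← Finsupp.smul_single]
    simp only [map_smul, map_single, boundary_single, map_sum]
    rfl

/-- The singular chain obtained from a chain of tuples of points of a simplex. -/
noncomputable def ofTuple {k : ℕ} (σ : C(TopSimplex k, X)) (m : ℕ) :
    TupleChains (TopSimplex k) m →ₗ[ℚ] SingChains X m :=
  Finsupp.lmapDomain ℚ ℚ fun v => σ.comp (affineMap v)

@[simp]
theorem ofTuple_single {k m : ℕ} (σ : C(TopSimplex k, X)) (v : Fin (m + 1) → TopSimplex k) (a : ℚ) :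
    ofTuple σ m (Finsupp.single v a) = Finsupp.single (σ.comp (affineMap v)) a := by
  simp [ofTuple]

theorem boundary_ofTuple {k : ℕ} (σ : C(TopSimplex k, X)) (m : ℕ)
    (c : TupleChains (TopSimplex k) (m + 1)) :
    boundary X m (ofTuple σ (m + 1) c) = ofTuple σ m (TupleChains.boundary _ m c) := by
  induction c using Finsupp.induction_linear with
  | zero => simp
  | add x y hx hy => simp only [map_add, hx, hy]
  | single v a =>
    rw [← mul_one a, ← smul_eq_mul, ← Finsupp.smul_single]
    simp only [map_smul, ofTuple_single, boundary_single, TupleChains.boundary_single, map_sum]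
    simp only [ContinuousMap.comp_assoc, affineMap_comp_face]

theorem ofTuple_map {k l : ℕ} (σ : C(TopSimplex k, X)) (u : Fin (l + 1) → TopSimplex k) (m : ℕ)
    (c : TupleChains (TopSimplex l) m) :
    ofTuple σ m (TupleChains.map (affineMap u) m c) = ofTuple (σ.comp (affineMap u)) m c := by
  induction c using Finsupp.induction_linear with
  | zero => simp
  | add x y hx hy => simp only [map_add, hx, hy]
  | single v a =>
    simp only [TupleChains.map_single, ofTuple_single, ContinuousMap.comp_assoc, affineMap_comp]

theorem map_ofTuple {k : ℕ} (g : C(X, Y)) (σ : C(TopSimplex k, X)) (m : ℕ)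
    (c : TupleChains (TopSimplex k) m) :
    map g m (ofTuple σ m c) = ofTuple (g.comp σ) m c := by
  induction c using Finsupp.induction_linear with
  | zero => simp
  | add x y hx hy => simp only [map_add, hx, hy]
  | single v a => simp only [map_single, ofTuple_single, ContinuousMap.comp_assoc]

/-- The chain homotopy from the identity to barycentric subdivision. -/
noncomputable def homotopy (X : Type) [TopologicalSpace X] (n : ℕ) :
    SingChains X n →ₗ[ℚ] SingChains X (n + 1) :=
  Finsupp.linearCombination ℚ fun σ =>
    ofTuple σ (n + 1) (TupleChains.homotopy (bary n) n (Finsupp.single stdSimplex.vertex 1))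

theorem homotopy_single {n : ℕ} (σ : C(TopSimplex n, X)) :
    homotopy X n (Finsupp.single σ 1) = ofTuple σ (n + 1)
      (TupleChains.homotopy (bary n) n (Finsupp.single stdSimplex.vertex 1)) := by
  simp [homotopy]

theorem homotopy_ofTuple {k : ℕ} (σ : C(TopSimplex k, X)) (m : ℕ)
    (c : TupleChains (TopSimplex k) m) :
    homotopy X m (ofTuple σ m c) = ofTuple σ (m + 1) (TupleChains.homotopy (bary k) m c) := by
  induction c using Finsupp.induction_linear with
  | zero => simp
  | add x y hx hy => simp only [map_add, hx, hy]
  | single v a =>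
    rw [← mul_one a, ← smul_eq_mul, ← Finsupp.smul_single]
    simp only [map_smul]
    rw [ofTuple_single, homotopy_single, ← ofTuple_map,
      TupleChains.map_homotopy (fun m w => affineMap_bary v w), TupleChains.map_single,
      affineMap_vertex]

theorem homotopy_map (g : C(X, Y)) (n : ℕ) (c : SingChains X n) :
    homotopy Y n (map g n c) = map g (n + 1) (homotopy X n c) := by
  induction c using Finsupp.induction_linear with
  | zero => simp
  | add x y hx hy => simp only [map_add, hx, hy]
  | single σ a =>
    rw [← mul_one a, ← smul_eq_mul, ← Finsupp.smul_single]
    simp only [map_smul, map_single, homotopy_single, map_ofTuple]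

/-- Barycentric subdivision of singular chains of positive degree. -/
noncomputable def subdivision (X : Type) [TopologicalSpace X] (n : ℕ) :
    SingChains X (n + 1) →ₗ[ℚ] SingChains X (n + 1) :=
  LinearMap.id - boundary X (n + 1) ∘ₗ homotopy X (n + 1) - homotopy X n ∘ₗ boundary X n

theorem subdivision_apply (n : ℕ) (c : SingChains X (n + 1)) :
    subdivision X n c = c - boundary X (n + 1) (homotopy X (n + 1) c)
      - homotopy X n (boundary X n c) := rfl

theorem subdivision_map (g : C(X, Y)) (n : ℕ) (c : SingChains X (n + 1)) :
    subdivision Y n (map g (n + 1) c) = map g (n + 1) (subdivision X n c) := by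
  simp only [subdivision_apply, map_sub, homotopy_map, boundary_map]

theorem subdivision_ofTuple {k : ℕ} (σ : C(TopSimplex k, X)) (m : ℕ)
    (c : TupleChains (TopSimplex k) (m + 1)) :
    subdivision X m (ofTuple σ (m + 1) c) =
      ofTuple σ (m + 1) (TupleChains.subdivision (bary k) (m + 1) c) := by
  rw [subdivision_apply, TupleChains.subdivision_succ]
  simp only [map_sub, homotopy_ofTuple, boundary_ofTuple]

theorem subdivision_pow_ofTuple {k : ℕ} (σ : C(TopSimplex k, X)) (m N : ℕ)
    (c : TupleChains (TopSimplex k) (m + 1)) :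
    (subdivision X m ^ N) (ofTuple σ (m + 1) c) =
      ofTuple σ (m + 1) ((TupleChains.subdivision (bary k) (m + 1) ^ N) c) := by
  induction N with
  | zero => rfl
  | succ N ih =>
    rw [pow_succ', pow_succ', Module.End.mul_apply, Module.End.mul_apply, ih, subdivision_ofTuple]

theorem boundary_boundary (n : ℕ) (c : SingChains X (n + 2)) :
    boundary X n (boundary X (n + 1) c) = 0 := by
  induction c using Finsupp.induction_linear with
  | zero => simp
  | add x y hx hy => simp only [map_add, hx, hy, add_zero]
  | single σ a =>
    have e : σ = σ.comp (affineMap stdSimplex.vertex) := by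
      ext1 t
      rw [ContinuousMap.comp_apply]
      congr 1
      apply Subtype.ext
      rw [affineMap_coe]
      funext j
      simp [Pi.single_apply]
      rfl
    rw [e, ← ofTuple_single, boundary_ofTuple, boundary_ofTuple, TupleChains.boundary_boundary,
      map_zero]

end SingChains

namespace SingChains

open TopSimplex

variable {X Y Z : Type} [TopologicalSpace X] [TopologicalSpace Y] [TopologicalSpace Z]

/-- Singular chains which are sums of chains coming from two spaces. -/
noncomputable def small (i : C(Y, X)) (j : C(Z, X)) (n : ℕ) : Submodule ℚ (SingChains X n) :=
  (map i n).range ⊔ (map j n).range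

theorem single_mem_range {i : C(Y, X)} (hi : Topology.IsEmbedding i) {n : ℕ}
    {σ : C(TopSimplex n, X)}
    (hσ : ∀ t, σ t ∈ Set.range i) : Finsupp.single σ 1 ∈ (map i n).range := by
  choose g hg using hσ
  have hc : Continuous g := by
    rw [hi.isInducing.continuous_iff]
    exact σ.continuous.congr fun t => (hg t).symm
  refine ⟨Finsupp.single ⟨g, hc⟩ 1, ?_⟩
  rw [map_single]
  congr 1
  ext t
  exact hg t

section

variable {i : C(Y, X)} {j : C(Z, X)}

theorem small_le {n m : ℕ} {L : SingChains X n →ₗ[ℚ] SingChains X m}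
    {L₁ : SingChains Y n →ₗ[ℚ] SingChains Y m} {L₂ : SingChains Z n →ₗ[ℚ] SingChains Z m}
    (h₁ : ∀ c, L (map i n c) = map i m (L₁ c)) (h₂ : ∀ c, L (map j n c) = map j m (L₂ c))
    {c : SingChains X n} (hc : c ∈ small i j n) : L c ∈ small i j m := by
  obtain ⟨_, ⟨a, rfl⟩, _, ⟨b, rfl⟩, rfl⟩ := Submodule.mem_sup.1 hc
  rw [map_add, h₁, h₂]
  exact Submodule.add_mem_sup ⟨_, rfl⟩ ⟨_, rfl⟩

theorem subdivision_pow_mem_small {n N : ℕ} {c : SingChains X (n + 1)}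
    (hc : c ∈ small i j (n + 1)) : (subdivision X n ^ N) c ∈ small i j (n + 1) := by
  induction N with
  | zero => exact hc
  | succ N ih =>
    rw [pow_succ', Module.End.mul_apply]
    exact small_le (subdivision_map i n) (subdivision_map j n) ih

theorem map_injective (hi : Function.Injective i) (n : ℕ) : Function.Injective (map i n) :=
  Finsupp.mapDomain_injective fun σ τ h => by
    ext t
    exact hi congr($h t)

theorem exists_of_map_eq_map {W : Type} [TopologicalSpace W] {p : C(W, Y)} {q : C(W, Z)}
    (hp : Topology.IsEmbedding p) (hj : Function.Injective j) (hpq : i.comp p = j.comp q)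
    (hr : ∀ y, i y ∈ Set.range j → y ∈ Set.range p) {n : ℕ} {x : SingChains Y n}
    {y : SingChains Z n} (hxy : map i n x = map j n y) (hi : Function.Injective i) :
    ∃ r, map p n r = x ∧ map q n r = y := by
  classical
  have hx : x ∈ (map p n).range := by
    rw [← Finsupp.sum_single x]
    refine Submodule.sum_mem _ fun σ hσ => ?_
    rw [← mul_one (x σ), ← smul_eq_mul, ← Finsupp.smul_single]
    refine Submodule.smul_mem _ _ (single_mem_range hp fun t => hr _ ?_)
    have h1 : i.comp σ ∈ (map j n y).support := by
      rw [← hxy]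
      rw [Finsupp.mem_support_iff] at hσ ⊢
      change Finsupp.mapDomain i.comp x (i.comp σ) ≠ 0
      rwa [Finsupp.mapDomain_apply]
      intro σ τ h
      ext t
      exact hi congr($h t)
    obtain ⟨τ, -, hτ⟩ := Finset.mem_image.1 (Finsupp.mapDomain_support h1)
    exact ⟨τ t, congr($hτ t)⟩
  obtain ⟨r, rfl⟩ := hx
  refine ⟨r, rfl, map_injective hj n ?_⟩
  rw [← hxy]
  have e (c : SingChains W n) : map j n (map q n c) = map i n (map p n c) := by
    induction c using Finsupp.induction_linear with
    | zero => simp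
    | add x y hx hy => simp only [map_add, hx, hy]
    | single σ a => simp only [map_single, ← ContinuousMap.comp_assoc, hpq]
  exact e r

theorem exists_subdivision_pow_single_mem_small (hi : Topology.IsOpenEmbedding i)
    (hj : Topology.IsOpenEmbedding j) (hij : Set.range i ∪ Set.range j = Set.univ) {n : ℕ}
    (σ : C(TopSimplex (n + 1), X)) :
    ∃ N, (subdivision X n ^ N) (Finsupp.single σ 1) ∈ small i j (n + 1) := by
  obtain ⟨δ, hδ, hball⟩ := lebesgue_number_lemma_of_metric (s := Set.univ)
    (c := fun b : Bool => σ ⁻¹' cond b (Set.range i) (Set.range j)) isCompact_univ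
    (fun b => by
      cases b
      · exact hj.isOpen_range.preimage σ.continuous
      · exact hi.isOpen_range.preimage σ.continuous)
    (fun t _ => by
      rw [Set.mem_iUnion]
      have : σ t ∈ Set.range i ∪ Set.range j := hij ▸ Set.mem_univ _
      rcases this with h | h
      · exact ⟨true, h⟩
      · exact ⟨false, h⟩)
  obtain ⟨N, hN⟩ := exists_pow_lt_of_lt_one hδ
    (show (((n + 1 : ℕ) : ℝ) / ((n + 1 : ℕ) + 1)) < 1 by
      rw [div_lt_one (by positivity)]; linarith)
  refine ⟨N, ?_⟩
  have e : Finsupp.single σ (1 : ℚ) = ofTuple σ (n + 1) (Finsupp.single stdSimplex.vertex 1) := by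
    rw [ofTuple_single]
    congr 1
    ext1 t
    rw [ContinuousMap.comp_apply]
    congr 1
    apply Subtype.ext
    rw [affineMap_coe]
    funext j
    simp [Pi.single_apply]
    rfl
  rw [e, subdivision_pow_ofTuple]
  set c := (TupleChains.subdivision (bary (n + 1)) (n + 1) ^ N) (Finsupp.single stdSimplex.vertex 1)
    with hc
  rw [← Finsupp.sum_single c, Finsupp.sum, map_sum]
  refine Submodule.sum_mem _ fun w hw => ?_
  rw [← mul_one (c w), ← smul_eq_mul, ← Finsupp.smul_single, map_smul, ofTuple_single]
  refine Submodule.smul_mem _ _ ?_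
  have hd : ∀ k l, dist (w k) (w l) < δ := fun k l => by
    refine lt_of_le_of_lt (TupleChains.dist_le_pow_mul_of_mem_support_subdivision_pow
      (val := fun t : TopSimplex (n + 1) => t.1) (D := 1) (bary_coe (n + 1)) (fun k l => ?_)
      N hw k l)
      (by simpa using hN)
    exact (Metric.dist_le_diam_of_mem (bounded_stdSimplex _) (stdSimplex.vertex k).2
      (stdSimplex.vertex l).2).trans diam_stdSimplex_le
  have hb : ∀ t, affineMap w t ∈ Metric.ball (w 0) δ := fun t => by
    have := (convex_ball (w 0).1 δ).sum_mem (t := Finset.univ) (w := t) (z := fun k => (w k).1)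
      (fun k _ => t.2.1 k) t.2.2 (fun k _ => hd k 0)
    exact this
  obtain ⟨b, hb'⟩ := hball (w 0) trivial
  cases b with
  | true => exact Submodule.mem_sup_left (single_mem_range hi.isEmbedding fun t => hb' (hb t))
  | false => exact Submodule.mem_sup_right (single_mem_range hj.isEmbedding fun t => hb' (hb t))

theorem exists_subdivision_pow_mem_small (hi : Topology.IsOpenEmbedding i)
    (hj : Topology.IsOpenEmbedding j) (hij : Set.range i ∪ Set.range j = Set.univ) {n : ℕ}
    (c : SingChains X (n + 1)) : ∃ N, (subdivision X n ^ N) c ∈ small i j (n + 1) := by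
  induction c using Finsupp.induction_linear with
  | zero => exact ⟨0, by simp⟩
  | add x y hx hy =>
    obtain ⟨N, hN⟩ := hx
    obtain ⟨M, hM⟩ := hy
    refine ⟨N + M, ?_⟩
    rw [map_add]
    refine Submodule.add_mem _ ?_ ?_
    · rw [add_comm N M, pow_add, Module.End.mul_apply]
      exact subdivision_pow_mem_small hN
    · rw [pow_add, Module.End.mul_apply]
      exact subdivision_pow_mem_small hM
  | single σ a =>
    obtain ⟨N, hN⟩ := exists_subdivision_pow_single_mem_small hi hj hij σ
    refine ⟨N, ?_⟩
    rw [← mul_one a, ← smul_eq_mul, ← Finsupp.smul_single, map_smul]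
    exact Submodule.smul_mem _ _ hN

theorem exists_sub_boundary_mem_small (hi : Topology.IsOpenEmbedding i)
    (hj : Topology.IsOpenEmbedding j) (hij : Set.range i ∪ Set.range j = Set.univ) {n : ℕ}
    (c : SingChains X (n + 1)) (hc : boundary X n c ∈ small i j n) :
    ∃ w, c - boundary X (n + 1) w ∈ small i j (n + 1) := by
  obtain ⟨N, hN⟩ := exists_subdivision_pow_mem_small hi hj hij c
  induction N generalizing c with
  | zero => exact ⟨0, by simpa using hN⟩
  | succ N ih =>
    have hh : homotopy X n (boundary X n c) ∈ small i j (n + 1) :=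
      small_le (fun c => homotopy_map i n c) (fun c => homotopy_map j n c) hc
    obtain ⟨w, hw⟩ := ih (subdivision X n c) (by
      rw [subdivision_apply, map_sub, map_sub, boundary_boundary, sub_zero]
      exact Submodule.sub_mem _ hc (small_le (fun c => boundary_map i n c)
        (fun c => boundary_map j n c) hh)) (by rwa [pow_succ, Module.End.mul_apply] at hN)
    refine ⟨w + homotopy X (n + 1) c, ?_⟩
    have e : c - boundary X (n + 1) (w + homotopy X (n + 1) c) =
        (subdivision X n c - boundary X (n + 1) w) + homotopy X n (boundary X n c) := by
      rw [subdivision_apply, map_add]; abel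
    rw [e]
    exact Submodule.add_mem _ hw hh

theorem small_zero_eq_top (hi : Topology.IsOpenEmbedding i)
    (hj : Topology.IsOpenEmbedding j) (hij : Set.range i ∪ Set.range j = Set.univ)
    (c : SingChains X 0) : c ∈ small i j 0 := by
  induction c using Finsupp.induction_linear with
  | zero => exact Submodule.zero_mem _
  | add x y hx hy => exact Submodule.add_mem _ hx hy
  | single σ a =>
    rw [← mul_one a, ← smul_eq_mul, ← Finsupp.smul_single]
    refine Submodule.smul_mem _ _ ?_
    have h0 (t : TopSimplex 0) : t = (default : stdSimplex ℝ (Fin 1)) :=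
      Subsingleton.elim _ _
    have h : σ default ∈ Set.range i ∪ Set.range j := hij ▸ Set.mem_univ _
    rcases h with h | h
    · exact Submodule.mem_sup_left (single_mem_range hi.isEmbedding fun t => h0 t ▸ h)
    · exact Submodule.mem_sup_right (single_mem_range hj.isEmbedding fun t => h0 t ▸ h)

end

/-- The chain modules of `singularChains` as finitely supported functions. -/
noncomputable def equiv (X : Type) [TopologicalSpace X] (n : ℕ) :
    (singularChains X).X n ≃ₗ[ℚ] SingChains X n :=
  Finsupp.domLCongr (TopCat.toSSetObjEquiv (TopCat.of X) (Opposite.op (SimplexCategory.mk n)))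

theorem equiv_single {n : ℕ}
    (σ : (TopCat.toSSet.obj (TopCat.of X)).obj (Opposite.op (SimplexCategory.mk n)))
    (a : ℚ) : equiv X n (Finsupp.single σ a : _ →₀ ℚ) =
      Finsupp.single (TopCat.toSSetObjEquiv (TopCat.of X) _ σ) a :=
  Finsupp.domLCongr_single _ _ _

/-- The map of singular chain complexes induced by a continuous map. -/
noncomputable def chainMap (g : C(X, Y)) : singularChains X ⟶ singularChains Y :=
  singularChainsFunctor.map (TopCat.ofHom g)

theorem chainMap_comp (g : C(X, Y)) (h : C(Y, Z)) :
    chainMap g ≫ chainMap h = chainMap (h.comp g) :=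
  (singularChainsFunctor.map_comp (TopCat.ofHom g) (TopCat.ofHom h)).symm

theorem equiv_map (g : C(X, Y)) (n : ℕ) (c : (singularChains X).X n) :
    equiv Y n (((chainMap g).f n).hom c) = map g n (equiv X n c) := by
  have h : (equiv Y n).toLinearMap ∘ₗ ((chainMap g).f n).hom =
      map g n ∘ₗ (equiv X n).toLinearMap := by
    refine Finsupp.lhom_ext fun σ a => ?_
    change equiv Y n (Finsupp.mapDomain ((TopCat.toSSet.map (TopCat.ofHom g)).app _)
      (Finsupp.single σ a)) = map g n (equiv X n (Finsupp.single σ a : _ →₀ ℚ))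
    rw [Finsupp.mapDomain_single, equiv_single, equiv_single, map_single]
    rfl
  exact congr($h c)

theorem _root_.ModuleCat.hom_sum_zsmul_apply {M N : ModuleCat.{0} ℚ} {ι : Type}
    (s : Finset ι) (z : ι → ℤ)
    (φ : ι → (M ⟶ N)) (x : M) :
    (∑ i ∈ s, z i • φ i).hom x = ∑ i ∈ s, z i • (φ i).hom x := by
  rw [ModuleCat.hom_sum, LinearMap.sum_apply]
  rfl

theorem d_single (n : ℕ) (σ : (TopCat.toSSet.obj (TopCat.of X)).obj
    (Opposite.op (SimplexCategory.mk (n + 1)))) (a : ℚ) :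
    ((singularChains X).d (n + 1) n).hom (Finsupp.single σ a : _ →₀ ℚ) =
      ∑ i : Fin (n + 2), (-1 : ℤ) ^ (i : ℕ) •
        (Finsupp.single ((TopCat.toSSet.obj (TopCat.of X)).δ i σ) a : _ →₀ ℚ) := by
  have hd : (singularChains X).d (n + 1) n = ∑ i : Fin (n + 2), (-1 : ℤ) ^ (i : ℕ) •
      SimplicialObject.δ (TopCat.toSSet.obj (TopCat.of X) ⋙ ModuleCat.free ℚ :
        SimplicialObject (ModuleCat ℚ)) i :=
    AlternatingFaceMapComplex.obj_d_eq _ _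
  refine (congrArg (fun φ => ModuleCat.Hom.hom φ (Finsupp.single σ a : _ →₀ ℚ)) hd).trans
    ((ModuleCat.hom_sum_zsmul_apply _ _ _ _).trans (Finset.sum_congr rfl fun i _ => ?_))
  congr 1
  exact Finsupp.mapDomain_single

theorem equiv_d (n : ℕ) (c : (singularChains X).X (n + 1)) :
    equiv X n ((singularChains X).d (n + 1) n c) = boundary X n (equiv X (n + 1) c) := by
  have h : (equiv X n).toLinearMap ∘ₗ ((singularChains X).d (n + 1) n).hom =
      boundary X n ∘ₗ (equiv X (n + 1)).toLinearMap := by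
    refine Finsupp.lhom_ext fun σ a => ?_
    refine (congrArg (equiv X n) (d_single n σ a)).trans ?_
    refine Eq.trans ?_ (congrArg (boundary X n) (equiv_single σ a).symm)
    refine (map_sum (equiv X n) _ _).trans ?_
    rw [← mul_one a, ← smul_eq_mul, ← Finsupp.smul_single, map_smul, boundary_single,
      Finset.smul_sum]
    refine Finset.sum_congr rfl fun i _ => ?_
    refine (map_zsmul (equiv X n) _ _).trans ?_
    refine (congrArg _ (equiv_single _ _)).trans ?_
    rw [smul_comm, Finsupp.smul_single a, ← Int.cast_smul_eq_zsmul ℚ]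
    push_cast
    rfl
  exact congr($h c)

end SingChains

open SingChains in
/-- **Mayer–Vietoris** for Euler characteristics of open subsets. -/
theorem eulerChar_union_add_inter {E : Type} [TopologicalSpace E] {U V : Set E} (hU : IsOpen U)
    (hV : IsOpen V) (hfU : HasFiniteHomology (singularChains U))
    (hfV : HasFiniteHomology (singularChains V))
    (hfUV : HasFiniteHomology (singularChains ↥(U ∩ V))) :
    HasFiniteHomology (singularChains ↥(U ∪ V)) ∧
      eulerChar ↥(U ∪ V) + eulerChar ↥(U ∩ V) = eulerChar U + eulerChar V := by
  let i : C(U, ↥(U ∪ V)) := ⟨Set.inclusion Set.subset_union_left, continuous_inclusion _⟩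
  let j : C(V, ↥(U ∪ V)) := ⟨Set.inclusion Set.subset_union_right, continuous_inclusion _⟩
  let p : C(↥(U ∩ V), U) := ⟨Set.inclusion Set.inter_subset_left, continuous_inclusion _⟩
  let q : C(↥(U ∩ V), V) := ⟨Set.inclusion Set.inter_subset_right, continuous_inclusion _⟩
  have hi : Topology.IsOpenEmbedding i :=
    .inclusion Set.subset_union_left (hU.preimage continuous_subtype_val)
  have hj : Topology.IsOpenEmbedding j :=
    .inclusion Set.subset_union_right (hV.preimage continuous_subtype_val)
  have hp : Topology.IsEmbedding p := .inclusion Set.inter_subset_left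
  have hij : Set.range i ∪ Set.range j = Set.univ := by
    refine Set.eq_univ_of_forall fun x => ?_
    rcases x with ⟨x, hx | hx⟩
    · exact Or.inl ⟨⟨x, hx⟩, rfl⟩
    · exact Or.inr ⟨⟨x, hx⟩, rfl⟩
  have hr {W : Type} [TopologicalSpace W] (g : C(W, ↥(U ∪ V))) (n : ℕ)
      (c : (singularChains ↥(U ∪ V)).X n) :
      equiv _ n c ∈ (map g n).range ↔ c ∈ ((chainMap g).f n).hom.range := by
    constructor
    · rintro ⟨x, hx⟩
      obtain ⟨x, rfl⟩ := (equiv _ n).surjective x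
      exact ⟨x, (equiv _ n).injective ((equiv_map g n x).trans hx)⟩
    · rintro ⟨x, rfl⟩
      exact ⟨equiv _ n x, (equiv_map g n x).symm⟩
  have key (n : ℕ) (c : (singularChains ↥(U ∪ V)).X n) :
      equiv _ n c ∈ small i j n ↔
        c ∈ ((chainMap i).f n).hom.range ⊔ ((chainMap j).f n).hom.range := by
    rw [small, Submodule.mem_sup, Submodule.mem_sup]
    constructor
    · rintro ⟨x, hx, y, hy, hxy⟩
      obtain ⟨x, rfl⟩ := (equiv _ n).surjective x
      obtain ⟨y, rfl⟩ := (equiv _ n).surjective y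
      rw [← map_add, EmbeddingLike.apply_eq_iff_eq] at hxy
      exact ⟨x, (hr i n x).1 hx, y, (hr j n y).1 hy, hxy⟩
    · rintro ⟨x, hx, y, hy, rfl⟩
      exact ⟨_, (hr i n x).2 hx, _, (hr j n y).2 hy, (map_add _ _ _).symm⟩
  refine eulerCharHomology_mayerVietoris (chainMap p) (chainMap q) (chainMap i) (chainMap j)
    ?_ ?_ ?_ ?_ hfUV hfU hfV
  · rw [chainMap_comp, chainMap_comp]
    rfl
  · intro n x y hxy
    apply (equiv _ n).injective
    apply map_injective hp.injective n
    rw [← equiv_map, ← equiv_map]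
    exact congrArg _ hxy
  · intro n x y hxy
    obtain ⟨r, h1, h2⟩ := exists_of_map_eq_map (i := i) (j := j) (p := p) (q := q)
      hp hj.injective rfl
      (by
        rintro y ⟨z, hz⟩
        have h : (z : E) = y := congrArg Subtype.val hz
        exact ⟨⟨y, y.2, h ▸ z.2⟩, rfl⟩)
      (x := equiv _ n x) (y := equiv _ n y) (by rw [← equiv_map, ← equiv_map]; exact congrArg _ hxy)
      hi.injective
    obtain ⟨r, rfl⟩ := (equiv _ n).surjective r
    rw [← equiv_map] at h1 h2
    exact ⟨r, (equiv _ n).injective h1, (equiv _ n).injective h2⟩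
  · intro n m hm
    cases n with
    | zero =>
      refine ⟨0, ?_⟩
      rw [map_zero, sub_zero, ← key]
      exact small_zero_eq_top hi hj hij _
    | succ n =>
      have hm' := (key n ((singularChains ↥(U ∪ V)).d (n + 1) n m)).2 hm
      rw [equiv_d] at hm'
      obtain ⟨w, hw⟩ := exists_sub_boundary_mem_small hi hj hij _ hm'
      obtain ⟨w, rfl⟩ := (equiv _ _).surjective w
      refine ⟨w, (key _ _).1 ?_⟩
      rw [map_sub]
      rw [← equiv_d] at hw
      exact hw

end Subdivision

namespace DegreeTheory

section

variable (D : DegreeTheory) {E : Type} [NormedAddCommGroup E] [NormedSpace ℝ E]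
  [FiniteDimensional ℝ E] {v : E → E}

theorem deg_empty (v : E → E) (y : E) : D.deg E v ∅ y = 0 := by
  have := D.additivity E v ∅ ∅ ∅ y isOpen_empty Bornology.isBounded_empty isOpen_empty isOpen_empty
    le_rfl le_rfl (by simp) (by simp) (by simp)
  omega

theorem deg_excision {A A₁ : Set E} {y : E} (hA : IsOpen A) (hb : Bornology.IsBounded A)
    (hA₁ : IsOpen A₁) (h : A₁ ⊆ A) (hv : ContinuousOn v (closure A))
    (hne : ∀ x ∈ closure A \ A₁, v x ≠ y) : D.deg E v A y = D.deg E v A₁ y := by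
  rw [D.additivity E v A A₁ ∅ y hA hb hA₁ isOpen_empty h (Set.empty_subset _) (by simp) hv
    (by simpa using hne), deg_empty, add_zero]

theorem deg_union_add_inter {U V : Set E} {y : E} (hU : IsOpen U) (hV : IsOpen V)
    (hbU : Bornology.IsBounded U) (hbV : Bornology.IsBounded V)
    (hv : ContinuousOn v (closure (U ∪ V))) (hUy : ∀ x ∈ frontier U, v x ≠ y)
    (hVy : ∀ x ∈ frontier V, v x ≠ y) :
    D.deg E v (U ∪ V) y + D.deg E v (U ∩ V) y = D.deg E v U y + D.deg E v V y := by
  rw [hU.frontier_eq] at hUy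
  rw [hV.frontier_eq] at hVy
  have hW : IsOpen (U \ closure V) := hU.sdiff isClosed_closure
  have h1 := D.additivity E v (U ∪ V) (U \ closure V) V y (hU.union hV) (hbU.union hbV) hW hV
    (Set.sdiff_subset.trans Set.subset_union_left) Set.subset_union_right
    (Set.disjoint_left.2 fun x hx hx' => hx.2 (subset_closure hx')) hv (by
      rintro x ⟨hx, hx'⟩
      rw [closure_union] at hx
      by_cases hxV : x ∈ closure V
      · exact hVy x ⟨hxV, fun h => hx' (Or.inr h)⟩
      · exact hUy x ⟨hx.resolve_right hxV, fun h => hx' (Or.inl ⟨h, hxV⟩)⟩)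
  have h2 := D.additivity E v U (U \ closure V) (U ∩ V) y hU hbU hW (hU.inter hV)
    Set.sdiff_subset Set.inter_subset_left
    (Set.disjoint_left.2 fun x hx hx' => hx.2 (subset_closure hx'.2))
    (hv.mono (closure_mono Set.subset_union_left)) (by
      rintro x ⟨hx, hx'⟩
      by_cases hxU : x ∈ U
      · have hxV : x ∈ closure V := by
          by_contra h
          exact hx' (Or.inl ⟨hxU, h⟩)
        exact hVy x ⟨hxV, fun h => hx' (Or.inr ⟨hxU, h⟩)⟩
      · exact hUy x ⟨hx, hxU⟩)
  omega

theorem deg_sub_const {A : Set E} (hA : IsOpen A) (hb : Bornology.IsBounded A) {p : E}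
    (hp : p ∈ A) : D.deg E (fun x => x - p) A 0 = 1 := by
  obtain ⟨R, hR⟩ := hb.subset_ball 0
  have hpR : ‖p‖ < R := by simpa using hR hp
  have hR0 : (0 : ℝ) < R := (norm_nonneg p).trans_lt hpR
  have h1 := D.normalization E (Metric.ball 0 R) 0 Metric.isOpen_ball Metric.isBounded_ball
    (Metric.mem_ball_self hR0)
  have h2 := D.homotopyInvariance E (fun t x => x - t • p) (Metric.ball 0 R) 0 Metric.isOpen_ball
    Metric.isBounded_ball (by fun_prop) (by
      intro t ht x hx h
      rw [frontier_ball _ hR0.ne', mem_sphere_zero_iff_norm] at hx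
      rw [sub_eq_zero] at h
      rw [h, norm_smul, Real.norm_of_nonneg ht.1] at hx
      have : t * ‖p‖ ≤ 1 * ‖p‖ := by gcongr; exact ht.2
      linarith)
  have h3 := D.deg_excision (v := fun x => x - p) (y := 0) Metric.isOpen_ball
    (Metric.isBounded_ball (x := (0 : E)) (r := R)) hA hR (by fun_prop) (by
      rintro x ⟨-, hx⟩ h
      rw [sub_eq_zero] at h
      exact hx (h ▸ hp))
  have e0 : (fun x : E => x - (0 : ℝ) • p) = id := by ext; simp
  have e1 : (fun x : E => x - (1 : ℝ) • p) = fun x => x - p := by ext; simp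
  simp only [e0, e1] at h2
  rw [← h3, ← h2, h1]

end

section Inner

variable (D : DegreeTheory) {E : Type} [NormedAddCommGroup E] [InnerProductSpace ℝ E]
  [FiniteDimensional ℝ E] {v w : E → E}

theorem deg_eq_of_inner_pos {A : Set E} (hA : IsOpen A) (hb : Bornology.IsBounded A)
    (hv : ContinuousOn v (closure A)) (hw : ContinuousOn w (closure A))
    (h : ∀ x ∈ frontier A, ∃ u : E, 0 < inner ℝ (v x) u ∧ 0 < inner ℝ (w x) u) :
    D.deg E v A 0 = D.deg E w A 0 := by
  have hs : ContinuousOn (fun p : ℝ × E => p.2) (Set.Icc (0:ℝ) 1 ×ˢ closure A) :=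
    continuous_snd.continuousOn
  have hm : Set.MapsTo (fun p : ℝ × E => p.2) (Set.Icc (0:ℝ) 1 ×ˢ closure A) (closure A) :=
    fun p hp => hp.2
  have hv' : ContinuousOn (fun p : ℝ × E => v p.2) (Set.Icc (0:ℝ) 1 ×ˢ closure A) := hv.comp hs hm
  have hw' : ContinuousOn (fun p : ℝ × E => w p.2) (Set.Icc (0:ℝ) 1 ×ˢ closure A) := hw.comp hs hm
  have h2 := D.homotopyInvariance E (fun t x => (1 - t) • v x + t • w x) A 0 hA hb
    (by fun_prop) (by
      intro t ht x hx h0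
      obtain ⟨u, h1, h2⟩ := h x hx
      have h3 := congrArg (fun z => inner ℝ z u) h0
      simp only [inner_add_left, real_inner_smul_left, inner_zero_left] at h3
      rcases eq_or_lt_of_le ht.1 with rfl | ht0
      · simp at h3; linarith
      · have := mul_pos ht0 h2
        have := mul_nonneg (sub_nonneg.2 ht.2) h1.le
        linarith)
  simpa using h2

end Inner

end DegreeTheory

/-- A bounded open set on which the Poincaré–Hopf formula holds for the vector field `v`. -/
structure IsPoincareHopf (D : DegreeTheory) {E : Type} [NormedAddCommGroup E] [NormedSpace ℝ E]
    [FiniteDimensional ℝ E] (v : E → E) (S : Set E) : Prop where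
  isOpen : IsOpen S
  isBounded : Bornology.IsBounded S
  continuousOn : ContinuousOn v (closure S)
  ne_zero : ∀ x ∈ frontier S, v x ≠ 0
  hasFiniteHomology : HasFiniteHomology (singularChains S)
  deg_eq : D.deg E v S 0 = eulerChar S

namespace IsPoincareHopf

variable {D : DegreeTheory}

section

variable {E : Type} [NormedAddCommGroup E] [NormedSpace ℝ E] [FiniteDimensional ℝ E] {v : E → E}

protected theorem empty : IsPoincareHopf D v ∅ where
  isOpen := isOpen_empty
  isBounded := Bornology.isBounded_empty
  continuousOn := by simp
  ne_zero := by simp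
  hasFiniteHomology := (hasFiniteHomology_and_eulerChar_of_isEmpty _).1
  deg_eq := (D.deg_empty v 0).trans (hasFiniteHomology_and_eulerChar_of_isEmpty _).2.symm

protected theorem union {U V : Set E} (hU : IsPoincareHopf D v U) (hV : IsPoincareHopf D v V)
    (hUV : IsPoincareHopf D v (U ∩ V)) : IsPoincareHopf D v (U ∪ V) := by
  have hc : ContinuousOn v (closure (U ∪ V)) := by
    rw [closure_union]
    exact hU.continuousOn.union_of_isClosed hV.continuousOn isClosed_closure isClosed_closure
  obtain ⟨h1, h2⟩ := eulerChar_union_add_inter hU.isOpen hV.isOpen hU.hasFiniteHomology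
    hV.hasFiniteHomology hUV.hasFiniteHomology
  have h3 := D.deg_union_add_inter hU.isOpen hV.isOpen hU.isBounded hV.isBounded hc hU.ne_zero
    hV.ne_zero
  refine ⟨hU.isOpen.union hV.isOpen, hU.isBounded.union hV.isBounded, hc, fun x hx => ?_, h1, ?_⟩
  · rcases frontier_union_subset U V hx with h | h
    · exact hU.ne_zero x h.1
    · exact hV.ne_zero x h.2
  · rw [hU.deg_eq, hV.deg_eq, hUV.deg_eq] at h3
    omega

theorem biUnion {ι : Type} {𝒢 : Set (Set E)} (h𝒢 : ∀ S ∈ 𝒢, IsPoincareHopf D v S)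
    (hinter : ∀ S ∈ 𝒢, ∀ T ∈ 𝒢, S ∩ T ∈ 𝒢) (s : Finset ι) (g : ι → Set E)
    (hg : ∀ i ∈ s, g i ∈ 𝒢) : IsPoincareHopf D v (⋃ i ∈ s, g i) := by
  classical
  induction s using Finset.induction_on generalizing g with
  | empty => simpa using IsPoincareHopf.empty
  | insert i s his ih =>
    rw [Finset.set_biUnion_insert]
    have hi := hg i (Finset.mem_insert_self _ _)
    have hs : ∀ j ∈ s, g j ∈ 𝒢 := fun j hj => hg j (Finset.mem_insert_of_mem hj)
    refine (h𝒢 _ hi).union (ih g hs) ?_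
    rw [Set.inter_iUnion₂]
    exact ih _ fun j hj => hinter _ hi _ (hs j hj)

end

variable {E : Type} [NormedAddCommGroup E] [InnerProductSpace ℝ E] [FiniteDimensional ℝ E]
  {v : E → E}

theorem of_starConvex {S : Set E} (hS : IsOpen S) (hb : Bornology.IsBounded S)
    (hv : ContinuousOn v (closure S)) {p : E} (hp : p ∈ S) (hstar : StarConvex ℝ p S)
    (h : ∀ x ∈ frontier S, ∃ u : E, 0 < inner ℝ (v x) u ∧ 0 < inner ℝ (x - p) u) :
    IsPoincareHopf D v S := by
  have := hstar.contractibleSpace ⟨p, hp⟩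
  obtain ⟨h1, h2⟩ := hasFiniteHomology_and_eulerChar_of_contractible S
  refine ⟨hS, hb, hv, fun x hx h0 => ?_, h1, ?_⟩
  · obtain ⟨u, hu, -⟩ := h x hx
    rw [h0, inner_zero_left] at hu
    exact hu.false
  · rw [h2, D.deg_eq_of_inner_pos hS hb hv (w := fun x => x - p) (by fun_prop) h,
      D.deg_sub_const hS hb hp]

end IsPoincareHopf

section

variable {E : Type} [NormedAddCommGroup E] [InnerProductSpace ℝ E]

/-- The midpoint of a chord of a ball can be moved by `d² / (8 r)` without leaving the ball. -/
theorem dist_midpoint_add_le {p z u c : E} {r : ℝ} (hr : 0 < r) (hp : dist p c ≤ r)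
    (hz : dist z c ≤ r) (hu : ‖u‖ ≤ ‖z - p‖ ^ 2 / (8 * r)) :
    dist (midpoint ℝ p z + u) c ≤ r := by
  rw [dist_eq_norm] at *
  have h1 := parallelogram_law_with_norm ℝ (p - c) (z - c)
  have h2 : p - c + (z - c) = (2 : ℝ) • (midpoint ℝ p z - c) := by
    rw [midpoint_eq_smul_add, invOf_eq_inv]; module
  have h3 : p - c - (z - c) = -(z - p) := by abel
  rw [h2, h3, norm_neg, norm_smul] at h1
  norm_num at h1
  set d := ‖z - p‖
  set m := ‖midpoint ℝ p z - c‖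
  have hm : m ^ 2 ≤ r ^ 2 - d ^ 2 / 4 := by nlinarith [norm_nonneg (p - c), norm_nonneg (z - c)]
  have hm0 : 0 ≤ m := norm_nonneg _
  have hmr : m ≤ r - d ^ 2 / (8 * r) := by
    have hd : d ^ 2 ≤ 4 * r ^ 2 := by nlinarith [sq_nonneg m]
    have he : d ^ 2 / (8 * r) * (8 * r) = d ^ 2 := by field_simp
    set e := d ^ 2 / (8 * r)
    have : 0 ≤ e := by positivity
    have her : e ≤ r := by nlinarith
    nlinarith [sq_nonneg e]
  calc ‖midpoint ℝ p z + u - c‖ = ‖(midpoint ℝ p z - c) + u‖ := by congr 1; abel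
    _ ≤ m + ‖u‖ := norm_add_le _ _
    _ ≤ r := by linarith

/-- If `f` is closely approximated to first order at `z`, and `f` is minimal at `p` among the points
of an intersection `K` of small balls, then the direction from `p` to `z` is an ascent direction of
`f` at `z`. -/
theorem inner_sub_pos_of_isMinOn {f : E → ℝ} {p z g : E} {r M : ℝ} {I : Set E} (hr : 0 < r)
    (hI : I.Nonempty)
    (hp : ∀ c ∈ I, dist p c ≤ r) (hz : ∀ c ∈ I, dist z c ≤ r) (hM : 0 ≤ M)
    (hmin : ∀ y, (∀ c ∈ I, dist y c ≤ r) → f p ≤ f y) (hpz : p ≠ z)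
    (hf : ∀ y, dist y z ≤ 2 * r → |f y - f z - inner ℝ g (y - z)| ≤ M * ‖y - z‖ ^ 2)
    (hg : 16 * M * r < ‖g‖) : 0 < inner ℝ g (z - p) := by
  set d := ‖z - p‖ with hd
  have hd0 : 0 < d := norm_pos_iff.2 (sub_ne_zero.2 hpz.symm)
  have hg0 : 0 < ‖g‖ := lt_of_le_of_lt (by positivity) hg
  set u : E := -((d ^ 2 / (8 * r) / ‖g‖) • g) with hu
  have hun : ‖u‖ = d ^ 2 / (8 * r) := by
    rw [hu, norm_neg, norm_smul, Real.norm_of_nonneg (by positivity)]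
    field_simp
  have hgu : inner ℝ g u = - (‖g‖ * (d ^ 2 / (8 * r))) := by
    rw [hu, inner_neg_right, inner_smul_right, real_inner_self_eq_norm_sq]
    field_simp
  have hK : ∀ c ∈ I, dist (midpoint ℝ p z + u) c ≤ r := fun c hc =>
    dist_midpoint_add_le hr (hp c hc) (hz c hc) hun.le
  have hdist : ∀ y, (∀ c ∈ I, dist y c ≤ r) → dist y z ≤ 2 * r := by
    obtain ⟨c, hc⟩ := hI
    intro y hy
    have := dist_triangle_right y z c
    linarith [hy c hc, hz c hc]
  have h1 := (abs_le.1 (hf _ (hdist _ hK))).2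
  have h2 := (abs_le.1 (hf _ (hdist _ hp))).1
  have h3 := hmin _ hK
  have hdr : d ≤ 2 * r := by
    have := hdist _ hp
    rwa [dist_comm, dist_eq_norm] at this
  have h4 : midpoint ℝ p z + u - z = -((1 / 2 : ℝ) • (z - p)) + u := by
    rw [midpoint_eq_smul_add, invOf_eq_inv]; module
  have h5 : p - z = -(z - p) := by abel
  have h6 : d ^ 2 / (8 * r) ≤ d / 4 := by
    rw [div_le_iff₀ (by positivity)]; nlinarith
  have h7 : ‖midpoint ℝ p z + u - z‖ ≤ d := by
    rw [h4]
    refine (norm_add_le _ _).trans ?_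
    rw [norm_neg, norm_smul, hun, ← hd]
    norm_num
    linarith
  have h8 : M * ‖midpoint ℝ p z + u - z‖ ^ 2 ≤ M * d ^ 2 := by gcongr
  rw [h5, inner_neg_right, norm_neg, ← hd] at h2
  have h9 : inner ℝ g (midpoint ℝ p z + u - z) =
      -(1 / 2 * inner ℝ g (z - p)) - ‖g‖ * (d ^ 2 / (8 * r)) := by
    rw [h4, inner_add_right, hgu, inner_neg_right, inner_smul_right]; ring
  rw [h9] at h1
  have h10 : 2 * M * d ^ 2 < ‖g‖ * (d ^ 2 / (8 * r)) := by
    have : 2 * M * d ^ 2 = 16 * M * r * (d ^ 2 / (8 * r)) := by field_simp; ring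
    rw [this]
    gcongr
  linarith

theorem inner_sub_sub_pos {x p c : E} {r : ℝ} (hx : dist x c = r) (hp : dist p c < r) :
    0 < inner ℝ (x - p) (x - c) := by
  rw [dist_eq_norm] at hx hp
  have h1 : x - p = (x - c) - (p - c) := by abel
  rw [h1, inner_sub_left, real_inner_self_eq_norm_sq]
  have := real_inner_le_norm (p - c) (x - c)
  rw [hx] at this ⊢
  nlinarith [norm_nonneg (p - c)]

end

section

variable {X : Type*} [PseudoMetricSpace X] {r : ℝ}

/-- The points of `S` at distance less than `r` from all points of `I`. -/
def ballCell (S : Set X) (r : ℝ) (I : Set X) : Set X := {x ∈ S | ∀ c ∈ I, dist x c < r}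

theorem ballCell_inter (S : Set X) (r : ℝ) (I J : Set X) :
    ballCell S r I ∩ ballCell S r J = ballCell S r (I ∪ J) := by
  ext x
  simp only [ballCell, Set.mem_inter_iff, Set.mem_ofPred_eq, Set.mem_union]
  grind

theorem isOpen_ballCell {S : Set X} (hS : IsOpen S) (r : ℝ) (I : Finset X) :
    IsOpen (ballCell S r (I : Set X)) := by
  have : ballCell S r (I : Set X) = S ∩ ⋂ c ∈ I, Metric.ball c r := by ext; simp [ballCell]
  rw [this]
  exact hS.inter (isOpen_biInter_finset fun _ _ => Metric.isOpen_ball)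

theorem dist_le_of_mem_closure_ballCell {S I : Set X} {x : X} (hx : x ∈ closure (ballCell S r I))
    {c : X} (hc : c ∈ I) : dist x c ≤ r :=
  closure_minimal (t := Metric.closedBall c r) (fun _ hy => (hy.2 c hc).le)
    Metric.isClosed_closedBall hx

theorem eq_or_exists_dist_eq_of_mem_frontier_ballCell {S : Set X} (hS : IsOpen S) {I : Finset X}
    {x : X} (hx : x ∈ frontier (ballCell S r (I : Set X))) :
    x ∈ frontier S ∨ ∃ c ∈ I, dist x c = r := by
  rw [(isOpen_ballCell hS r I).frontier_eq] at hx
  rw [hS.frontier_eq]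
  by_contra! hcon
  refine hx.2 ⟨?_, fun c hc => (dist_le_of_mem_closure_ballCell hx.1 hc).lt_of_ne (hcon.2 c hc)⟩
  by_contra hxS
  exact hcon.1 ⟨closure_mono (fun y hy => hy.1) hx.1, hxS⟩

/-- All but finitely many radii are generic: a family of closed balls meets `closure S` only if
the open balls meet `S`. -/
theorem exists_radius_forall_ballCell_nonempty (S : Set X) (T : Finset X) {r₀ : ℝ} (hr₀ : 0 < r₀) :
    ∃ r ∈ Set.Ioo (r₀ / 2) r₀, ∀ I ⊆ T,
      (∃ x ∈ closure S, ∀ c ∈ I, dist x c ≤ r) → (ballCell S r (I : Set X)).Nonempty := by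
  classical
  let bad (I : Finset X) : Set ℝ := {r | (∃ x ∈ closure S, ∀ c ∈ I, dist x c ≤ r) ∧
    ¬ (ballCell S r (I : Set X)).Nonempty}
  have hbad : ∀ I r r', r ∈ bad I → r' ∈ bad I → ¬ r < r' := by
    rintro I r r' ⟨⟨x, hx, hxI⟩, -⟩ ⟨-, hr'⟩ hlt
    have hopen : IsOpen (⋂ c ∈ I, Metric.ball c r') :=
      isOpen_biInter_finset fun _ _ => Metric.isOpen_ball
    obtain ⟨y, hy, hyS⟩ := mem_closure_iff.1 hx _ hopen
      (by simpa using fun c hc => (hxI c hc).trans_lt hlt)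
    exact hr' ⟨y, hyS, by simpa using hy⟩
  have hfin : (⋃ I ∈ T.powerset, bad I).Finite :=
    T.powerset.finite_toSet.biUnion fun I _ => Set.Subsingleton.finite fun r hr r' hr' =>
      le_antisymm (not_lt.1 (hbad I r' r hr' hr)) (not_lt.1 (hbad I r r' hr hr'))
  obtain ⟨r, hr, hr'⟩ := (Set.Ioo_infinite (half_lt_self hr₀)).exists_notMem_finite hfin
  refine ⟨r, hr, fun I hI hx => ?_⟩
  by_contra hne
  exact hr' (Set.mem_biUnion (Finset.mem_powerset.2 hI) ⟨hx, hne⟩)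

end

section

open Filter Topology

variable {E : Type} [NormedAddCommGroup E] [InnerProductSpace ℝ E] [FiniteDimensional ℝ E]

variable {U : Set E} {f : E → ℝ} {h : E → E} {b r M : ℝ}

theorem exists_center_of_ballCell_nonempty (hU : IsOpen U)
    (hf : ∀ x ∈ U, HasGradientAt f (h x) x) (hh : ContinuousOn h U)
    (hcpt : IsCompact (closure {x ∈ U | f x < b})) (hcl : closure {x ∈ U | f x < b} ⊆ U)
    {I : Set E} (hI : I.Nonempty) (hr : 0 < r) (hM : 0 ≤ M)
    (hIU : ∀ y, (∀ c ∈ I, dist y c ≤ r) → y ∈ U)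
    (hfM : ∀ z ∈ closure {x ∈ U | f x < b}, ∀ y, dist y z ≤ 2 * r →
      |f y - f z - inner ℝ (h z) (y - z)| ≤ M * ‖y - z‖ ^ 2)
    (hhM : ∀ z ∈ closure {x ∈ U | f x < b}, f z = b → 16 * M * r < ‖h z‖)
    (hne : (ballCell {x ∈ U | f x < b} r I).Nonempty) :
    ∃ p ∈ ballCell {x ∈ U | f x < b} r I, ∀ z ∈ closure {x ∈ U | f x < b},
      (∀ c ∈ I, dist z c ≤ r) → f z = b → 0 < inner ℝ (h z) (z - p) := by
  set S := {x ∈ U | f x < b} with hS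
  have hfc : ContinuousOn f U := fun x hx => (hf x hx).continuousAt.continuousWithinAt
  obtain ⟨q, ⟨hqU, hqb⟩, hqI⟩ := hne
  set K : Set E := {y | ∀ c ∈ I, dist y c ≤ r} with hK
  have hKclosed : IsClosed K := by
    have : K = ⋂ c ∈ I, Metric.closedBall c r := by ext; simp [hK]
    rw [this]
    exact isClosed_biInter fun _ _ => Metric.isClosed_closedBall
  have hKcpt : IsCompact K := by
    obtain ⟨c, hc⟩ := hI
    exact (isCompact_closedBall c r).of_isClosed_subset hKclosed fun y hy => hy c hc
  have hKU : K ⊆ U := hIU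
  have hqK : q ∈ K := fun c hc => (hqI c hc).le
  obtain ⟨p, hpK, hp⟩ := hKcpt.exists_isMinOn ⟨q, hqK⟩ (hfc.mono hKU)
  have hpb : f p < b := (hp hqK).trans_lt hqb
  set Z : Set E := {z ∈ closure S | z ∈ K ∧ f z = b} with hZ
  have hZcpt : IsCompact Z := by
    have h1 : IsCompact (closure S ∩ K) := hcpt.inter_right hKclosed
    have : Z = (closure S ∩ K) ∩ f ⁻¹' {b} := by
      ext
      simp only [hZ, Set.mem_ofPred_eq, Set.mem_inter_iff, Set.mem_preimage,
        Set.mem_singleton_iff, and_assoc]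
    rw [this]
    exact h1.of_isClosed_subset ((hfc.mono fun x hx => hcl hx.1).preimage_isClosed_of_isClosed
      h1.isClosed isClosed_singleton) Set.inter_subset_left
  have hpos : ∀ z ∈ Z, 0 < inner ℝ (h z) (z - p) := fun z hz =>
    inner_sub_pos_of_isMinOn hr hI hpK hz.2.1 hM (fun y hy => hp hy)
      (by rintro rfl; exact hpb.ne hz.2.2) (hfM z hz.1) (hhM z hz.1 hz.2.2)
  have hline : Continuous fun t : ℝ => p + t • (q - p) := by fun_prop
  have hev1 : ∀ᶠ t in 𝓝[>] (0 : ℝ), ∀ z ∈ Z, 0 < inner ℝ (h z) (z - (p + t • (q - p))) := by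
    refine (hZcpt.eventually_forall_of_forall_eventually fun z hz => ?_).filter_mono
      nhdsWithin_le_nhds
    have hc : ContinuousAt (fun w : ℝ × E => inner ℝ (h w.2) (w.2 - (p + w.1 • (q - p)))) (0, z) :=
      ((hh.continuousAt (hU.mem_nhds (hcl hz.1))).comp (x := ((0 : ℝ), z)) (g := h) (f := Prod.snd)
        continuousAt_snd).inner (by fun_prop)
    exact hc.eventually_const_lt (by simpa using hpos z hz)
  have hev2 : ∀ᶠ t in 𝓝[>] (0 : ℝ), p + t • (q - p) ∈ U ∧ f (p + t • (q - p)) < b := by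
    have h0 : p + (0 : ℝ) • (q - p) = p := by simp
    have hpU := hU.mem_nhds (hKU hpK)
    have h2 : ∀ᶠ y in 𝓝 p, y ∈ U ∧ f y < b :=
      Filter.Eventually.and hpU ((hfc.continuousAt hpU).eventually_lt_const hpb)
    exact ((hline.tendsto' 0 p h0).eventually h2).filter_mono nhdsWithin_le_nhds
  have hev3 : ∀ᶠ t in 𝓝[>] (0 : ℝ), t ∈ Set.Ioo (0 : ℝ) 1 := Ioo_mem_nhdsGT one_pos
  obtain ⟨t, h1, h2, ht⟩ := (hev1.and (hev2.and hev3)).exists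
  refine ⟨_, ⟨h2, fun c hc => ?_⟩, fun z hz hzK hzb => h1 z ⟨hz, hzK, hzb⟩⟩
  have : p + t • (q - p) - c = (1 - t) • (p - c) + t • (q - c) := by module
  rw [dist_eq_norm, this]
  refine (norm_add_le _ _).trans_lt ?_
  rw [norm_smul, norm_smul, Real.norm_of_nonneg ht.1.le, Real.norm_of_nonneg (by linarith [ht.2])]
  have h3 := hpK c hc
  have h4 := hqI c hc
  rw [dist_eq_norm] at h3 h4
  nlinarith [ht.1, ht.2]

theorem starConvex_ballCell (hf : ∀ x ∈ U, HasGradientAt f (h x) x) {I : Set E}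
    (hIU : ∀ y, (∀ c ∈ I, dist y c ≤ r) → y ∈ U) {p : E}
    (hp : p ∈ ballCell {x ∈ U | f x < b} r I)
    (hpos : ∀ z ∈ closure {x ∈ U | f x < b},
      (∀ c ∈ I, dist z c ≤ r) → f z = b → 0 < inner ℝ (h z) (z - p)) :
    StarConvex ℝ p (ballCell {x ∈ U | f x < b} r I) := by
  intro x hx a t ha ht hat
  have hline : ∀ s : ℝ, p + s • (x - p) - p = s • (x - p) := fun s => by module
  have hball : ∀ s ∈ Set.Icc (0 : ℝ) 1, ∀ c ∈ I, dist (p + s • (x - p)) c < r := by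
    intro s hs c hc
    have := (convex_ball c r).add_smul_sub_mem (hp.2 c hc) (hx.2 c hc) hs
    exact this
  have hU' : ∀ s ∈ Set.Icc (0 : ℝ) 1, p + s • (x - p) ∈ U := fun s hs =>
    hIU _ fun c hc => (hball s hs c hc).le
  set g : ℝ → ℝ := fun s => f (p + s • (x - p)) with hg
  have hderiv : ∀ s ∈ Set.Icc (0 : ℝ) 1,
      HasDerivAt g (inner ℝ (h (p + s • (x - p))) (x - p)) s := by
    intro s hs
    have h1 : HasDerivAt (fun s : ℝ => p + s • (x - p)) (x - p) s := by
      simpa using ((hasDerivAt_id s).smul_const (x - p)).const_add p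
    have h2 := (hf _ (hU' s hs)).hasFDerivAt.comp_hasDerivAt s h1
    rwa [InnerProductSpace.toDual_apply_apply] at h2
  have hgc : ContinuousOn g (Set.Icc 0 1) := fun s hs =>
    (hderiv s hs).continuousAt.continuousWithinAt
  have ht1 : t ∈ Set.Icc (0 : ℝ) 1 := ⟨ht, by linarith⟩
  have hat' : a • p + t • x = p + t • (x - p) := by
    rw [← eq_sub_iff_add_eq] at hat
    rw [hat]; module
  rw [hat']
  refine ⟨⟨hU' t ht1, ?_⟩, hball t ht1⟩
  by_contra! hgt
  have hZ : IsCompact (Set.Icc (0 : ℝ) 1 ∩ g ⁻¹' Set.Ici b) :=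
    isCompact_Icc.of_isClosed_subset (hgc.preimage_isClosed_of_isClosed isClosed_Icc isClosed_Ici)
      Set.inter_subset_left
  obtain ⟨τ, ⟨hτ, hτb⟩, hmax⟩ := hZ.exists_isGreatest ⟨t, ht1, hgt⟩
  have hg0 : g 0 < b := by simpa [hg] using hp.1.2
  have hg1 : g 1 < b := by simpa [hg] using hx.1.2
  have hτ0 : 0 < τ := hτ.1.lt_of_ne (by rintro rfl; exact hg0.not_ge hτb)
  have hτ1 : τ < 1 := hτ.2.lt_of_ne (by rintro rfl; exact hg1.not_ge hτb)
  have hafter : ∀ᶠ s in 𝓝[>] τ, p + s • (x - p) ∈ U ∧ g s < b := by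
    filter_upwards [Ioo_mem_nhdsGT hτ1] with s hs
    have hs' : s ∈ Set.Icc (0 : ℝ) 1 := ⟨hτ.1.trans hs.1.le, hs.2.le⟩
    refine ⟨hU' s hs', ?_⟩
    by_contra! hsb
    exact hs.1.not_ge (hmax ⟨hs', hsb⟩)
  have hlt := (hderiv τ hτ).continuousAt.tendsto.mono_left (nhdsWithin_le_nhds (s := Set.Ioi τ))
  have hτeq : g τ = b := le_antisymm (le_of_tendsto hlt (hafter.mono fun s hs => hs.2.le)) hτb
  have hcont : Continuous fun s : ℝ => p + s • (x - p) := by fun_prop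
  have hcl : p + τ • (x - p) ∈ closure {x ∈ U | f x < b} :=
    mem_closure_of_tendsto (hcont.continuousAt.tendsto.mono_left nhdsWithin_le_nhds) hafter
  have hpos' := hpos _ hcl (fun c hc => (hball τ hτ c hc).le) hτeq
  rw [hline, inner_smul_right] at hpos'
  have hpos'' := pos_of_mul_pos_right hpos' hτ0.le
  have hslope : Tendsto (slope g τ) (𝓝[>] τ) _ :=
    (hasDerivAt_iff_tendsto_slope.1 (hderiv τ hτ)).mono_left
      (nhdsWithin_mono τ (fun s (hs : τ < s) => hs.ne'))
  obtain ⟨s, hs1, hs2, hs3⟩ :=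
    ((hslope.eventually_const_lt hpos'').and (hafter.and self_mem_nhdsWithin)).exists
  have := (slope_pos_iff_of_le (le_of_lt hs3)).1 hs1

  linarith [hs2.2]

end

section

open Filter Topology

variable {E : Type} [NormedAddCommGroup E] [InnerProductSpace ℝ E]

variable {U : Set E} {f : E → ℝ} {h : E → E} {b r M : ℝ}

theorem exists_abs_sub_sub_inner_gradient_le [FiniteDimensional ℝ E] {F : Set E} (hU : IsOpen U)
    (hf : ContDiffOn ℝ 2 f U) (hF : IsCompact F) (hFU : F ⊆ U) :
    ∃ δ > 0, ∃ M, 0 ≤ M ∧ ∀ z ∈ F, Metric.closedBall z δ ⊆ U ∧ ∀ y, dist y z ≤ δ →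
      |f y - f z - inner ℝ (gradient f z) (y - z)| ≤ M * ‖y - z‖ ^ 2 := by
  obtain ⟨δ, hδ, hsub⟩ := hF.exists_cthickening_subset_open hU hFU
  have hf1 : ContDiffOn ℝ 1 (fderiv ℝ f) U := hf.fderiv_of_isOpen hU (by norm_num)
  obtain ⟨M, hM⟩ := (hF.cthickening (r := δ)).exists_bound_of_continuousOn
    ((hf1.continuousOn_fderiv_of_isOpen hU le_rfl).mono hsub)
  refine ⟨δ, hδ, max M 0, le_max_right _ _, fun z hz => ?_⟩
  have hball := Metric.closedBall_subset_cthickening hz δ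
  refine ⟨hball.trans hsub, fun y hy => ?_⟩
  have hlip : ∀ x ∈ Metric.closedBall z δ, ‖fderiv ℝ f x - fderiv ℝ f z‖ ≤ max M 0 * ‖x - z‖ :=
    fun x hx => (convex_closedBall z δ).norm_image_sub_le_of_norm_fderiv_le
      (fun w hw => (hf1.differentiableOn one_ne_zero).differentiableAt
        (hU.mem_nhds (hsub (hball hw))))
      (fun w hw => (hM w (hball hw)).trans (le_max_left _ _))
      (Metric.mem_closedBall_self hδ.le) hx
  have hsmall : Metric.closedBall z (dist y z) ⊆ Metric.closedBall z δ :=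
    Metric.closedBall_subset_closedBall hy
  have := (convex_closedBall z (dist y z)).norm_image_sub_le_of_norm_hasFDerivWithin_le'
    (f := f) (φ := fderiv ℝ f z) (C := max M 0 * ‖y - z‖) (f' := fderiv ℝ f)
    (fun w hw => ((hf.differentiableOn two_ne_zero).differentiableAt
        (hU.mem_nhds (hsub (hball (hsmall hw))))).hasFDerivAt.hasFDerivWithinAt)
    (fun w hw => (hlip w (hsmall hw)).trans (by
      rw [Metric.mem_closedBall, dist_eq_norm, dist_eq_norm] at hw
      gcongr))
    (Metric.mem_closedBall_self dist_nonneg) (y := y) (Metric.mem_closedBall.2 le_rfl)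
  rw [Real.norm_eq_abs] at this
  have hg : inner ℝ (gradient f z) (y - z) = fderiv ℝ f z (y - z) := by
    rw [gradient, InnerProductSpace.toDual_symm_apply]
  rw [hg]
  linarith

/-- A continuous vector field on a compact set that points out of each of finitely many spheres and
upwards on a level set of `f`, provided this can be arranged pointwise. -/
theorem exists_continuousOn_forall_inner_pos {F : Set E} (hf : ContinuousOn f F)
    (hh : ContinuousOn h F) (T : Finset E)
    (hT : ∀ x ∈ F, ∃ w : E, (∀ c ∈ T, dist x c = r → 0 < inner ℝ w (x - c)) ∧
      (f x = b → 0 < inner ℝ w (h x))) :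
    ∃ v : E → E, ContinuousOn v F ∧ ∀ x ∈ F,
      (∀ c ∈ T, dist x c = r → 0 < inner ℝ (v x) (x - c)) ∧
      (f x = b → 0 < inner ℝ (v x) (h x)) := by
  classical
  let t : F → Set E := fun x => {w | (∀ c ∈ T, dist (x : E) c = r → 0 < inner ℝ w ((x : E) - c)) ∧
      (f x = b → 0 < inner ℝ w (h x))}
  have ht : ∀ x, Convex ℝ (t x) := by
    rintro x w₁ ⟨h1, h2⟩ w₂ ⟨h3, h4⟩ a b ha hb hab
    have key : ∀ u : E, 0 < inner ℝ w₁ u → 0 < inner ℝ w₂ u → 0 < inner ℝ (a • w₁ + b • w₂) u := by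
      intro u hu₁ hu₂
      rw [inner_add_left, real_inner_smul_left, real_inner_smul_left]
      rcases ha.eq_or_lt with rfl | ha
      · have : b = 1 := by linarith
        simpa [this] using hu₂
      · positivity
    exact ⟨fun c hc hxc => key _ (h1 c hc hxc) (h3 c hc hxc), fun hx => key _ (h2 hx) (h4 hx)⟩
  obtain ⟨g, hg⟩ := exists_continuous_forall_mem_convex_of_local_const ht (by
    intro x
    obtain ⟨w, hw1, hw2⟩ := hT x x.2
    have hfc : Continuous fun y : F => f y := continuousOn_iff_continuous_domRestrict.1 hf
    have hhc : Continuous fun y : F => h y := continuousOn_iff_continuous_domRestrict.1 hh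
    refine ⟨w, ((eventually_all_finset T).2 fun c hc => ?_).and ?_⟩
    · by_cases hxc : dist (x : E) c = r
      · have : Continuous fun y : F => inner ℝ w ((y : E) - c) := by fun_prop
        exact (this.continuousAt.eventually_const_lt (hw1 c hc hxc)).mono fun y hy _ => hy
      · have : Continuous fun y : F => dist (y : E) c := by fun_prop
        exact (this.continuousAt.eventually_ne hxc).mono fun y hy h => absurd h hy
    · by_cases hxb : f x = b
      · have : Continuous fun y : F => inner ℝ w (h y) := continuous_const.inner hhc
        exact (this.continuousAt.eventually_const_lt (hw2 hxb)).mono fun y hy _ => hy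
      · exact (hfc.continuousAt.eventually_ne hxb).mono fun y hy h => absurd h hy)
  refine ⟨fun x => if hx : x ∈ F then g ⟨x, hx⟩ else 0, ?_, fun x hx => ?_⟩
  · rw [continuousOn_iff_continuous_domRestrict]
    convert g.continuous using 1
    ext x
    simp
  · simp only [hx, dite_true]
    exact hg ⟨x, hx⟩

end

section

variable {E : Type} [NormedAddCommGroup E] [InnerProductSpace ℝ E] [FiniteDimensional ℝ E]

theorem deg_gradient_eq_eulerChar_sublevel (D : DegreeTheory) {U : Set E} (hU : IsOpen U)
    {f : E → ℝ} (hf : ContDiffOn ℝ 2 f U) {b : ℝ}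
    (hcpt : IsCompact (closure {x ∈ U | f x < b})) (hcl : closure {x ∈ U | f x < b} ⊆ U)
    (hreg : ∀ x ∈ U, f x = b → gradient f x ≠ 0) :
    D.deg E (gradient f) {x ∈ U | f x < b} 0 = eulerChar {x ∈ U | f x < b} := by
  classical
  have hfc : ContinuousOn f U := hf.continuousOn
  have hgrad : ∀ x ∈ U, HasGradientAt f (gradient f x) x := fun x hx =>
    ((hf.differentiableOn two_ne_zero).differentiableAt (hU.mem_nhds hx)).hasGradientAt
  have hgradc : ContinuousOn (gradient f) U :=
    (InnerProductSpace.toDual ℝ E).symm.continuous.comp_continuousOn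
      (hf.continuousOn_fderiv_of_isOpen hU one_le_two)
  obtain ⟨δ, hδ, M, hM, hδM⟩ := exists_abs_sub_sub_inner_gradient_le hU hf hcpt hcl
  set S := {x ∈ U | f x < b} with hS
  have hSo : IsOpen S := hfc.isOpen_inter_preimage hU isOpen_Iio
  have hfr : ∀ x ∈ frontier S, f x = b := by
    intro x hx
    rw [hSo.frontier_eq] at hx
    have hxU := hcl hx.1
    refine le_antisymm ?_ (not_lt.1 fun h => hx.2 ⟨hxU, h⟩)
    exact ((hfc x hxU).mono fun y hy => hy.1).closure_le hx.1 continuousWithinAt_const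
      fun y hy => hy.2.le
  obtain ⟨m, hm, hmin⟩ : ∃ m > 0, ∀ z ∈ closure S, f z = b → m ≤ ‖gradient f z‖ := by
    have hZ : IsCompact (closure S ∩ f ⁻¹' {b}) := hcpt.of_isClosed_subset
      ((hfc.mono hcl).preimage_isClosed_of_isClosed isClosed_closure isClosed_singleton)
      Set.inter_subset_left
    rcases (closure S ∩ f ⁻¹' {b}).eq_empty_or_nonempty with he | hne
    · exact ⟨1, one_pos, fun z hz hzb => (Set.eq_empty_iff_forall_notMem.1 he z ⟨hz, hzb⟩).elim⟩
    · obtain ⟨z, hz, hmin⟩ :=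
        hZ.exists_isMinOn hne (hgradc.norm.mono (Set.inter_subset_left.trans hcl))
      exact ⟨_, norm_pos_iff.2 (hreg z (hcl hz.1) hz.2), fun y hy hyb => hmin ⟨hy, hyb⟩⟩
  obtain ⟨r₀, hr₀, hr₀δ, hr₀M⟩ : ∃ r₀ > 0, 2 * r₀ ≤ δ ∧ 16 * M * r₀ < m := by
    have h1 : 0 < m / (16 * M + 1) := by positivity
    have h0 := min_le_left (δ / 2) (m / (16 * M + 1))
    refine ⟨min (δ / 2) (m / (16 * M + 1)), by positivity, by linarith, ?_⟩
    have h2 := min_le_right (δ / 2) (m / (16 * M + 1))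
    have h3 : m / (16 * M + 1) * (16 * M + 1) = m := by field_simp
    have h4 : 0 < min (δ / 2) (m / (16 * M + 1)) := by positivity
    nlinarith
  obtain ⟨T, hTS, hcover⟩ := hcpt.elim_finite_subcover_image
    (b := closure S) (c := fun c => Metric.ball c (r₀ / 2))
    (fun _ _ => Metric.isOpen_ball)
    (fun x hx => Set.mem_biUnion hx (Metric.mem_ball_self (by positivity)))
  obtain ⟨hTfin, hcover⟩ := hcover
  lift T to Finset E using hTfin
  obtain ⟨r, ⟨hr1, hr2⟩, hrne⟩ := exists_radius_forall_ballCell_nonempty S T hr₀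
  have hr : 0 < r := by linarith
  have hIU : ∀ I ⊆ T, I.Nonempty → ∀ y, (∀ c ∈ I, dist y c ≤ r) → y ∈ U := by
    rintro I hI ⟨c, hc⟩ y hy
    exact (hδM c (hTS (hI hc))).1 (Metric.mem_closedBall.2 (by linarith [hy c hc]))
  have hcenter : ∀ I ⊆ T, I.Nonempty → (ballCell S r (I : Set E)).Nonempty →
      ∃ p ∈ ballCell S r (I : Set E), ∀ z ∈ closure S,
        (∀ c ∈ I, dist z c ≤ r) → f z = b → 0 < inner ℝ (gradient f z) (z - p) :=
    fun I hI hIne hne => exists_center_of_ballCell_nonempty hU hgrad hgradc hcpt hcl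
      (Finset.coe_nonempty.2 hIne) hr hM (hIU I hI hIne)
      (fun z hz y hy => (hδM z hz).2 y (by linarith))
      (fun z hz hzb => lt_of_le_of_lt (by gcongr) (hr₀M.trans_le (hmin z hz hzb))) hne
  obtain ⟨v, hv, hvpos⟩ := exists_continuousOn_forall_inner_pos (r := r) (b := b) (hfc.mono hcl)
      (hgradc.mono hcl) T (by
    intro x hx
    set J := T.filter fun c => dist x c = r with hJ
    rcases J.eq_empty_or_nonempty with hJe | hJne
    · refine ⟨gradient f x, fun c hc hxc => ?_, fun hxb => ?_⟩
      · exact absurd (Finset.mem_filter.2 ⟨hc, hxc⟩) (by rw [← hJ, hJe]; simp)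
      · exact real_inner_self_pos.2 (hreg x (hcl hx) hxb)
    · have hJr : ∀ c ∈ J, dist x c = r := fun c hc => (Finset.mem_filter.1 hc).2
      obtain ⟨p, hp, hpos⟩ := hcenter J (Finset.filter_subset _ _) hJne
        (hrne J (Finset.filter_subset _ _) ⟨x, hx, fun c hc => (hJr c hc).le⟩)
      refine ⟨x - p, fun c hc hxc => ?_, fun hxb => ?_⟩
      · exact inner_sub_sub_pos hxc (hp.2 c (Finset.mem_filter.2 ⟨hc, hxc⟩))
      · rw [real_inner_comm]
        exact hpos x hx (fun c hc => (hJr c hc).le) hxb)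
  have hcell : ∀ I ⊆ T, I.Nonempty → IsPoincareHopf D v (ballCell S r (I : Set E)) := by
    intro I hI hIne
    rcases (ballCell S r (I : Set E)).eq_empty_or_nonempty with he | hne
    · rw [he]; exact IsPoincareHopf.empty
    obtain ⟨p, hp, hpos⟩ := hcenter I hI hIne hne
    have hsub : closure (ballCell S r (I : Set E)) ⊆ closure S := closure_mono fun x hx => hx.1
    refine IsPoincareHopf.of_starConvex (isOpen_ballCell hSo r I)
      (hcpt.isBounded.subset fun x hx => subset_closure hx.1) (hv.mono hsub) hp
      (starConvex_ballCell hgrad (hIU I hI hIne) hp hpos) fun x hx => ?_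
    have hxc := frontier_subset_closure hx
    rcases eq_or_exists_dist_eq_of_mem_frontier_ballCell hSo hx with h | ⟨c, hc, hxr⟩
    · refine ⟨gradient f x, (hvpos x (hsub hxc)).2 (hfr x h), ?_⟩
      rw [real_inner_comm]
      exact hpos x (hsub hxc) (fun c hc => dist_le_of_mem_closure_ballCell hxc hc) (hfr x h)
    · exact ⟨x - c, (hvpos x (hsub hxc)).1 c (hI hc) hxr, inner_sub_sub_pos hxr (hp.2 c hc)⟩
  have hunion : ⋃ c ∈ T, ballCell S r ({c} : Set E) = S := by
    refine Set.Subset.antisymm (Set.iUnion₂_subset fun c _ x hx => hx.1) fun x hx => ?_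
    obtain ⟨c, hc, hxc⟩ := Set.mem_iUnion₂.1 (hcover (subset_closure hx))
    refine Set.mem_biUnion hc ⟨hx, ?_⟩
    rintro _ rfl
    exact (Metric.mem_ball.1 hxc).trans hr1
  have hPH : IsPoincareHopf D v S := by
    rw [← hunion]
    refine IsPoincareHopf.biUnion
      (𝒢 := {A | ∃ I ⊆ T, I.Nonempty ∧ A = ballCell S r (I : Set E)}) ?_ ?_ T _ ?_
    · rintro _ ⟨I, hI, hIne, rfl⟩
      exact hcell I hI hIne
    · rintro _ ⟨I, hI, hIne, rfl⟩ _ ⟨J, hJ, -, rfl⟩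
      exact ⟨I ∪ J, Finset.union_subset hI hJ, hIne.mono Finset.subset_union_left, by
        rw [ballCell_inter, Finset.coe_union]⟩
    · exact fun c hc => ⟨{c}, Finset.singleton_subset_iff.2 hc,
        Finset.singleton_nonempty c, by simp⟩
  rw [← hPH.deg_eq]
  refine D.deg_eq_of_inner_pos hSo hPH.isBounded (hgradc.mono hcl) hv fun x hx => ?_
  have hxS := frontier_subset_closure hx
  exact ⟨gradient f x, real_inner_self_pos.2 (hreg x (hcl hxS) (hfr x hx)),
    (hvpos x hxS).2 (hfr x hx)⟩

end

/-- Poincaré–Hopf for gradient fields on sublevel sets: if `f ∈ C²(U,ℝ)`, the sublevel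
set `f^b = {x ∈ U : f(x) < b}` has compact closure contained in `U`, and `f` has no
critical point on `f⁻¹(b)`, then the Brouwer degree of `∇f` on `f^b` at `0` equals the
Euler characteristic of `f^b`. -/
theorem degree_gradient_eq_eulerChar (D : DegreeTheory) (n : ℕ)
    (U : Set (EuclideanSpace ℝ (Fin n))) (hU : IsOpen U)
    (f : EuclideanSpace ℝ (Fin n) → ℝ) (hf : ContDiffOn ℝ 2 f U) (b : ℝ)
    (hcpt : IsCompact (closure {x ∈ U | f x < b}))
    (hcl : closure {x ∈ U | f x < b} ⊆ U)
    (hreg : ∀ x ∈ U, f x = b → gradient f x ≠ 0) :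
    D.deg (EuclideanSpace ℝ (Fin n)) (gradient f) {x ∈ U | f x < b} 0 =
      eulerChar {x ∈ U | f x < b} := by
  exact deg_gradient_eq_eulerChar_sublevel D hU hf hcpt hcl hreg
end

section
/- Let f : ℝ² → ℝ² be continuous on the closure of a bounded open set A ⊂ ℝ^n with f ≠ 0 on ∂A, and suppose A = A₁ × A₂ with f(x₁,x₂) = (f₁(x₁), f₂(x₂)) a product vector field, f₁ ≠ 0 on ∂A₁, f₂ ≠ 0 on ∂A₂. Then the Brouwer degree satisfies deg(f, A, 0) = deg(f₁, A₁, 0) · deg(f₂, A₂, 0). -/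
open Set Metric Topology

open LinearEquiv in
theorem LinearEquiv.induction_on_dilatransvections {K V : Type*} [Field K] [Infinite K]
    [AddCommGroup V] [Module K V] [Module.Finite K V] {P : (V ≃ₗ[K] V) → Prop}
    (hdil : ∀ T ∈ dilatransvections K V, P T) (hmul : ∀ S T, P S → P T → P (S * T))
    (L : V ≃ₗ[K] V) : P L := by
  by_cases hfix : ∀ x, L x = x
  · rw [show L = 1 from LinearEquiv.ext hfix]
    exact hdil 1 one_mem_dilatransvections
  push Not at hfix
  obtain ⟨x, hx⟩ := hfix
  have hLx : L x ∉ L.fixedSubmodule := fun h => hx (L.injective h)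
  have hx' : x ∉ L.fixedSubmodule := hx
  obtain ⟨q, hq⟩ := Module.exists_dual_forall_apply_ne_zero (K := K)
    ![L.fixedSubmodule.mkQ x, L.fixedSubmodule.mkQ (L x)] (by
      intro i
      fin_cases i <;> simpa)
  have hq0 : q (L.fixedSubmodule.mkQ x) ≠ 0 := hq 0
  have hq1 : q (L.fixedSubmodule.mkQ (L x)) ≠ 0 := hq 1
  let l : Module.Dual K V := (q (L.fixedSubmodule.mkQ (L x)))⁻¹ • (q ∘ₗ L.fixedSubmodule.mkQ)
  have hlx : l x ≠ 0 := mul_ne_zero (inv_ne_zero hq1) hq0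
  have hlL : l (L x) = 1 := inv_mul_cancel₀ hq1
  have hlF : ∀ y ∈ L.fixedSubmodule, l y = 0 := fun y hy => by
    simp [l, (Submodule.Quotient.mk_eq_zero _).2 hy]
  have hunit : IsUnit (1 + l (x - L x)) := by
    rw [map_sub, hlL, add_sub_cancel]
    exact hlx.isUnit
  let T := dilatransvection hunit
  have hT : T ∈ dilatransvections K V := dilatransvection_mem_dilatransvections
  have hTa : ∀ y, T y = y + l y • (x - L x) := fun y => dilatransvection.apply
  have hle : L.fixedSubmodule < (T * L).fixedSubmodule := by
    refine lt_of_le_of_ne (fun y hy => ?_) fun h => hx' ?_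
    · have hy' : L y = y := hy
      change T (L y) = y
      rw [hy', hTa, hlF y hy, zero_smul, add_zero]
    · rw [h]
      change T (L x) = x
      rw [hTa, hlL, one_smul, add_sub_cancel]
  have hlt := Submodule.finrank_lt_finrank_of_lt hle
  have hV := Submodule.finrank_le (T * L).fixedSubmodule
  rw [← inv_mul_cancel_left T L]
  exact hmul _ _ (hdil _ (inv_mem_dilatransvections_iff.2 hT))
    (induction_on_dilatransvections hdil hmul (T * L))
termination_by Module.finrank K V - Module.finrank K L.fixedSubmodule
decreasing_by exact Nat.sub_lt_sub_left (hlt.trans_le hV) hlt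

theorem ContDiff.exists_norm_lt_forall_eq_exists_hasFDerivAt {E : Type*} [NormedAddCommGroup E]
    [NormedSpace ℝ E] [FiniteDimensional ℝ E] {g : E → E} (hg : ContDiff ℝ 1 g) {ε : ℝ}
    (hε : 0 < ε) :
    ∃ y, ‖y‖ < ε ∧ ∀ x, g x = y → ∃ L : E ≃L[ℝ] E, HasFDerivAt g (L : E →L[ℝ] E) x := by
  let _ : MeasurableSpace E := borel E
  have : BorelSpace E := ⟨rfl⟩
  have hd : ∀ x, HasFDerivAt g (fderiv ℝ g x) x := fun x =>
    (hg.differentiable one_ne_zero x).hasFDerivAt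
  have hsard := MeasureTheory.addHaar_image_eq_zero_of_det_fderivWithin_eq_zero
    (MeasureTheory.Measure.addHaar (G := E)) (s := {x | (fderiv ℝ g x).det = 0})
    (fun x _ => (hd x).hasFDerivWithinAt) fun x hx => hx
  obtain ⟨y, hy, hys⟩ : ∃ y ∈ ball (0 : E) ε, y ∉ g '' {x | (fderiv ℝ g x).det = 0} := by
    by_contra! h
    exact (measure_ball_pos MeasureTheory.Measure.addHaar (0 : E) hε).ne'
      (MeasureTheory.measure_mono_null h hsard)
  refine ⟨y, by simpa using hy, fun x hx => ?_⟩
  have hdet : (fderiv ℝ g x).det ≠ 0 := fun h => hys ⟨x, h, hx⟩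
  exact ⟨(fderiv ℝ g x).toContinuousLinearEquivOfDetNeZero hdet, by simpa using hd x⟩

section VanishingTheorem

variable {E : Type*} [NormedAddCommGroup E]

/-- An integer-valued function of pairs `(f, A)` that satisfies the additivity and homotopy
invariance axioms of a degree at the value `0`, without any normalization. -/
structure IsDegreeLike (e : (E → E) → Set E → ℤ) : Prop where
  additivity : ∀ (f : E → E) (A A₁ A₂ : Set E), IsOpen A → Bornology.IsBounded A →
    IsOpen A₁ → IsOpen A₂ → A₁ ⊆ A → A₂ ⊆ A → Disjoint A₁ A₂ → ContinuousOn f (closure A) →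
    (∀ x ∈ closure A \ (A₁ ∪ A₂), f x ≠ 0) → e f A = e f A₁ + e f A₂
  homotopyInvariance : ∀ (H : ℝ → E → E) (A : Set E), IsOpen A → Bornology.IsBounded A →
    ContinuousOn (fun p : ℝ × E => H p.1 p.2) (Icc (0 : ℝ) 1 ×ˢ closure A) →
    (∀ t ∈ Icc (0 : ℝ) 1, ∀ x ∈ frontier A, H t x ≠ 0) → e (H 0) A = e (H 1) A

namespace IsDegreeLike

variable {e : (E → E) → Set E → ℤ}

theorem sub {e' : (E → E) → Set E → ℤ} (he : IsDegreeLike e) (he' : IsDegreeLike e') :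
    IsDegreeLike fun f A => e f A - e' f A where
  additivity f A A₁ A₂ h1 h2 h3 h4 h5 h6 h7 h8 h9 := by
    rw [he.additivity f A A₁ A₂ h1 h2 h3 h4 h5 h6 h7 h8 h9,
      he'.additivity f A A₁ A₂ h1 h2 h3 h4 h5 h6 h7 h8 h9]
    ring
  homotopyInvariance H A h1 h2 h3 h4 := by
    rw [he.homotopyInvariance H A h1 h2 h3 h4, he'.homotopyInvariance H A h1 h2 h3 h4]

theorem mul_const (he : IsDegreeLike e) (c : ℤ) : IsDegreeLike fun f A => e f A * c where
  additivity f A A₁ A₂ h1 h2 h3 h4 h5 h6 h7 h8 h9 := by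
    rw [he.additivity f A A₁ A₂ h1 h2 h3 h4 h5 h6 h7 h8 h9]
    ring
  homotopyInvariance H A h1 h2 h3 h4 := by
    rw [he.homotopyInvariance H A h1 h2 h3 h4]

theorem empty (he : IsDegreeLike e) (f : E → E) : e f ∅ = 0 := by
  have := he.additivity f ∅ ∅ ∅ isOpen_empty Bornology.isBounded_empty isOpen_empty isOpen_empty
    subset_rfl subset_rfl (disjoint_empty _) (by simp) (by simp)
  omega

theorem excision (he : IsDegreeLike e) {f : E → E} {A B : Set E} (hA : IsOpen A)
    (hb : Bornology.IsBounded A) (hB : IsOpen B) (hBA : B ⊆ A) (hf : ContinuousOn f (closure A))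
    (h0 : ∀ x ∈ closure A, f x = 0 → x ∈ B) : e f A = e f B := by
  have := he.additivity f A B ∅ hA hb hB isOpen_empty hBA (empty_subset _) (disjoint_empty _) hf
    (fun x hx h => hx.2 (Or.inl (h0 x hx.1 h)))
  rw [this, he.empty, add_zero]

theorem eq_zero_of_forall_ne (he : IsDegreeLike e) {f : E → E} {A : Set E} (hA : IsOpen A)
    (hb : Bornology.IsBounded A) (hf : ContinuousOn f (closure A))
    (h0 : ∀ x ∈ closure A, f x ≠ 0) : e f A = 0 := by
  rw [he.excision hA hb isOpen_empty (empty_subset _) hf fun x hx h => (h0 x hx h).elim, he.empty]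

variable [NormedSpace ℝ E]

theorem eq_of_segment (he : IsDegreeLike e) {f g : E → E} {A : Set E} (hA : IsOpen A)
    (hb : Bornology.IsBounded A) (hf : ContinuousOn f (closure A))
    (hg : ContinuousOn g (closure A))
    (h0 : ∀ t ∈ Icc (0 : ℝ) 1, ∀ x ∈ frontier A, f x + t • (g x - f x) ≠ 0) :
    e f A = e g A := by
  have := he.homotopyInvariance (fun t x => f x + t • (g x - f x)) A hA hb
    (by
      have hf' : ContinuousOn (fun p : ℝ × E => f p.2) (Icc (0 : ℝ) 1 ×ˢ closure A) :=
        hf.comp continuousOn_snd fun p hp => hp.2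
      have hg' : ContinuousOn (fun p : ℝ × E => g p.2) (Icc (0 : ℝ) 1 ×ˢ closure A) :=
        hg.comp continuousOn_snd fun p hp => hp.2
      exact hf'.add (continuousOn_fst.smul (hg'.sub hf')))
    h0
  simpa using this

theorem congr (he : IsDegreeLike e) {f g : E → E} {A : Set E} (hA : IsOpen A)
    (hb : Bornology.IsBounded A) (hf : ContinuousOn f (closure A))
    (hfg : EqOn f g (closure A)) (h0 : ∀ x ∈ frontier A, f x ≠ 0) : e f A = e g A :=
  he.eq_of_segment hA hb hf (hf.congr hfg.symm) fun t _ x hx => by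
    rw [← hfg (frontier_subset_closure hx)]
    simpa using h0 x hx

theorem eq_of_norm_sub_lt (he : IsDegreeLike e) {f g : E → E} {A : Set E} (hA : IsOpen A)
    (hb : Bornology.IsBounded A) (hf : ContinuousOn f (closure A))
    (hg : ContinuousOn g (closure A)) (h0 : ∀ x ∈ frontier A, ‖g x - f x‖ < ‖f x‖) :
    e f A = e g A := by
  refine he.eq_of_segment hA hb hf hg fun t ht x hx h => ?_
  have h1 : ‖f x‖ = t * ‖g x - f x‖ := by
    rw [← Real.norm_of_nonneg ht.1, ← norm_smul, eq_neg_of_add_eq_zero_right h, norm_neg]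
  have := h0 x hx
  nlinarith [ht.2, norm_nonneg (g x - f x)]

section FiniteDimensional

variable [FiniteDimensional ℝ E]

theorem comp_linearEquiv (he : IsDegreeLike e) (L : E ≃ₗ[ℝ] E) :
    IsDegreeLike fun f A => e (fun x => L (f x)) A where
  additivity f A A₁ A₂ h1 h2 h3 h4 h5 h6 h7 h8 h9 :=
    he.additivity _ A A₁ A₂ h1 h2 h3 h4 h5 h6 h7
      (L.toLinearMap.continuous_of_finiteDimensional.comp_continuousOn h8)
      (fun x hx => by simpa using h9 x hx)
  homotopyInvariance H A h1 h2 h3 h4 :=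
    he.homotopyInvariance (fun t x => L (H t x)) A h1 h2
      (L.toLinearMap.continuous_of_finiteDimensional.comp_continuousOn h3)
      (fun t ht x hx => by simpa using h4 t ht x hx)

theorem linearEquiv_translate (he : IsDegreeLike e) (L : E ≃ₗ[ℝ] E) {A B : Set E} {a : E}
    (hA : IsOpen A) (hAb : Bornology.IsBounded A) (h0 : (0 : E) ∈ A)
    (hB : IsOpen B) (hBb : Bornology.IsBounded B) (ha : a ∈ B) :
    e (fun x => L (x - a)) B = e L A := by
  have hL : Continuous L := L.toLinearMap.continuous_of_finiteDimensional
  obtain ⟨R, hR⟩ := (hAb.union hBb).subset_ball (0 : E)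
  have hAR : A ⊆ ball 0 R := subset_union_left.trans hR
  have hBR : B ⊆ ball 0 R := subset_union_right.trans hR
  have hLa : Continuous fun x => L (x - a) := hL.comp (continuous_id.sub continuous_const)
  rw [← he.excision isOpen_ball isBounded_ball hA hAR hL.continuousOn
      (fun x _ hx => by rw [(map_eq_zero_iff L L.injective).1 hx]; exact h0),
    ← he.excision isOpen_ball isBounded_ball hB hBR hLa.continuousOn
      (fun x _ hx => by
        rw [sub_eq_zero.1 ((map_eq_zero_iff L L.injective).1 hx)]; exact ha)]
  symm
  refine he.eq_of_segment isOpen_ball isBounded_ball hL.continuousOn hLa.continuousOn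
    fun t ht x hx h => ?_
  have hx' : ‖x‖ = R := by simpa using frontier_ball_subset_sphere hx
  have haR : ‖a‖ < R := by simpa using hBR ha
  rw [← map_sub, ← map_smul, ← map_add, map_eq_zero_iff L L.injective] at h
  have hxa : x = t • a := by
    rw [sub_sub_cancel_left, smul_neg] at h
    exact add_neg_eq_zero.1 h
  rw [hxa, norm_smul, Real.norm_of_nonneg ht.1] at hx'
  nlinarith [ht.2, norm_nonneg a]

theorem linearEquiv_of_dual_pos (he : IsDegreeLike e) (hid : e id (ball 0 1) = 0)
    (L : E ≃ₗ[ℝ] E) (l : Module.Dual ℝ E) (v : E) (hL : ∀ x, L x = x + l x • v)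
    (hlv : 0 < 1 + l v) : e L (ball 0 1) = 0 := by
  rw [← hid]
  symm
  refine he.eq_of_segment isOpen_ball isBounded_ball continuousOn_id
    L.toLinearMap.continuous_of_finiteDimensional.continuousOn fun t ht x hx h => ?_
  have hx' : ‖x‖ = 1 := by simpa using frontier_ball_subset_sphere hx
  rw [hL, id, add_sub_cancel_left] at h
  have hl : l x * (1 + t * l v) = 0 := by
    have := congrArg l h
    simp only [map_add, map_smul, smul_eq_mul, map_zero] at this
    linear_combination this
  have hpos : 0 < 1 + t * l v := by
    by_cases h1 : t = 1
    · simpa [h1] using hlv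
    · have := lt_of_le_of_ne ht.2 h1
      nlinarith [ht.1]
  have hlx : l x = 0 := (mul_eq_zero.1 hl).resolve_right hpos.ne'
  rw [hlx] at h
  have : x = 0 := by simpa using h
  simp [this] at hx'

theorem linearEquiv_of_dual_neg (he : IsDegreeLike e) (hid : e id (ball 0 1) = 0)
    (L : E ≃ₗ[ℝ] E) (l : Module.Dual ℝ E) (v : E) (hL : ∀ x, L x = x + l x • v)
    (hlv : 1 + l v < 0) : e L (ball 0 1) = 0 := by
  have hLc : Continuous L := L.toLinearMap.continuous_of_finiteDimensional
  have hlc : Continuous l := l.continuous_of_finiteDimensional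
  obtain ⟨d, hd⟩ : ∃ d, d = 1 + l v := ⟨_, rfl⟩
  rw [← hd] at hlv
  obtain ⟨w, hw⟩ : ∃ w, w = (l v)⁻¹ • v := ⟨_, rfl⟩
  have hlv0 : l v ≠ 0 := by linarith
  have hvw : v = (d - 1) • w := by rw [hw, hd, add_sub_cancel_left, smul_inv_smul₀ hlv0]
  have hlw : l w = 1 := by rw [hw, map_smul, smul_eq_mul, inv_mul_cancel₀ hlv0]
  -- the piecewise linear fold of `E` along the hyperplane `l = 0`
  let g : ℝ → E → E := fun t x => x + (max (l x) (d * l x) - l x - 1 + 2 * t) • w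
  have hgc : ∀ t, Continuous (g t) := fun t => by fun_prop
  have hlg : ∀ t x, l (g t x) = max (l x) (d * l x) - 1 + 2 * t := fun t x => by
    simp only [g, map_add, map_smul, hlw, smul_eq_mul]; ring
  have hd1 : 0 < -d⁻¹ := neg_pos.2 (inv_neg''.2 hlv)
  have hdd : d * d⁻¹ = 1 := mul_inv_cancel₀ hlv.ne
  set R : ℝ := (1 + -d⁻¹) * ‖w‖ + 1 with hR
  have hRw : ∀ s : ℝ, d⁻¹ ≤ s → s ≤ 1 → ‖s • w‖ < R := fun s h1 h2 => by
    rw [norm_smul, Real.norm_eq_abs]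
    have : |s| ≤ 1 + -d⁻¹ := abs_le.2 ⟨by linarith, by linarith⟩
    nlinarith [norm_nonneg w]
  have hgne : ∀ t ∈ Icc (0 : ℝ) 1, ∀ x ∈ frontier (ball (0 : E) R), g t x ≠ 0 := by
    intro t ht x hx h
    have hx' : ‖x‖ = R := by simpa using frontier_ball_subset_sphere hx
    have h1 : max (l x) (d * l x) = 1 - 2 * t := by
      have := hlg t x
      rw [h, map_zero] at this
      linarith
    have hxw : x = l x • w := by
      have h2 : x + (max (l x) (d * l x) - l x - 1 + 2 * t) • w = 0 := h
      rw [h1] at h2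
      rw [eq_neg_of_add_eq_zero_left h2, ← neg_smul]
      congr 1
      simp only [map_smul, hlw, smul_eq_mul]
      ring
    have h3 := le_max_left (l x) (d * l x)
    have h4 := le_max_right (l x) (d * l x)
    have := hRw (l x) (by nlinarith [ht.1]) (by linarith [ht.1])
    rw [← hxw] at this
    linarith
  have hzero : e (g 0) (ball 0 R) = 0 := by
    rw [he.homotopyInvariance g (ball 0 R) isOpen_ball isBounded_ball
      (by simp only [g]; fun_prop) hgne]
    refine he.eq_zero_of_forall_ne isOpen_ball isBounded_ball (hgc 1).continuousOn
      fun x _ h => ?_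
    have h1 := hlg 1 x
    rw [h, map_zero] at h1
    have h3 := le_max_left (l x) (d * l x)
    have h4 := le_max_right (l x) (d * l x)
    rcases le_total 0 (l x) with h5 | h5 <;> nlinarith
  let P : Set E := ball 0 R ∩ {x | 0 < l x}
  let N : Set E := ball 0 R ∩ {x | l x < 0}
  have hPo : IsOpen P := isOpen_ball.inter (isOpen_lt continuous_const hlc)
  have hNo : IsOpen N := isOpen_ball.inter (isOpen_lt hlc continuous_const)
  have hPb : Bornology.IsBounded P := isBounded_ball.subset inter_subset_left
  have hNb : Bornology.IsBounded N := isBounded_ball.subset inter_subset_left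
  have hPc : ∀ x ∈ closure P, 0 ≤ l x := fun x hx =>
    closure_minimal (fun y (hy : y ∈ P) => le_of_lt hy.2)
      (isClosed_le continuous_const hlc) hx
  have hNc : ∀ x ∈ closure N, l x ≤ 0 := fun x hx =>
    closure_minimal (fun y (hy : y ∈ N) => le_of_lt hy.2)
      (isClosed_le hlc continuous_const) hx
  have hsplit : e (g 0) (ball 0 R) = e (g 0) P + e (g 0) N := by
    refine he.additivity _ _ P N isOpen_ball isBounded_ball hPo hNo inter_subset_left
      inter_subset_left (disjoint_left.2 fun x hx hx' => lt_asymm (show 0 < l x from hx.2) hx'.2)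
      (hgc 0).continuousOn fun x hx h => ?_
    have hxR : x ∈ ball 0 R := by
      by_contra hxR
      exact hgne 0 ⟨le_rfl, zero_le_one⟩ x
        (by rw [isOpen_ball.frontier_eq]; exact ⟨hx.1, hxR⟩) h
    rcases lt_trichotomy (l x) 0 with h1 | h1 | h1
    · exact hx.2 (Or.inr ⟨hxR, h1⟩)
    · have := hlg 0 x
      rw [h, map_zero, h1] at this
      simp at this
    · exact hx.2 (Or.inl ⟨hxR, h1⟩)
  have hP : EqOn (fun x => LinearEquiv.refl ℝ E (x - w)) (g 0) (closure P) := fun x hx => by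
    have := hPc x hx
    have h1 : max (l x) (d * l x) = l x := max_eq_left (by nlinarith)
    simp [g, h1, sub_eq_add_neg]
  have hLw : ∀ x, L (x - d⁻¹ • w) = L x - w := fun x => by
    rw [map_sub, hL (d⁻¹ • w), hvw, map_smul, hlw, smul_smul, ← add_smul, smul_eq_mul, mul_one]
    rw [show d⁻¹ + d⁻¹ * (d - 1) = 1 by linear_combination hdd, one_smul]
  have hN : EqOn (fun x => L (x - d⁻¹ • w)) (g 0) (closure N) := fun x hx => by
    have := hNc x hx
    have h1 : max (l x) (d * l x) = d * l x := max_eq_right (by nlinarith)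
    simp only [g, h1]
    rw [hLw, hL, hvw, smul_smul, add_sub_assoc]
    congr 1
    rw [← sub_eq_zero]
    module
  have hwP : w ∈ P := ⟨by simpa using hRw 1 (by linarith) le_rfl, by simp [hlw]⟩
  have hwN : d⁻¹ • w ∈ N :=
    ⟨by simpa using hRw d⁻¹ le_rfl (by linarith), by simpa [hlw] using hlv⟩
  have heP : e (g 0) P = 0 := by
    have hwc : Continuous fun x => LinearEquiv.refl ℝ E (x - w) :=
      continuous_id.sub continuous_const
    rw [← he.congr hPo hPb hwc.continuousOn hP, he.linearEquiv_translate _ isOpen_ball isBounded_ball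
      (mem_ball_self one_pos) hPo hPb hwP]
    · exact hid
    · intro x hx h
      rw [sub_eq_zero.1 h] at hx
      exact (hPo.frontier_eq ▸ hx).2 hwP
  have heN : e (g 0) N = e L (ball 0 1) := by
    have hLwc : Continuous fun x => L (x - d⁻¹ • w) :=
      hLc.comp (continuous_id.sub continuous_const)
    rw [← he.congr hNo hNb hLwc.continuousOn hN,
      he.linearEquiv_translate _ isOpen_ball isBounded_ball (mem_ball_self one_pos) hNo hNb hwN]
    intro x hx h
    rw [sub_eq_zero.1 ((map_eq_zero_iff L L.injective).1 h)] at hx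
    exact (hNo.frontier_eq ▸ hx).2 hwN
  linarith

theorem linearEquiv_eq_zero (he : IsDegreeLike e) (hid : e id (ball 0 1) = 0) (L : E ≃ₗ[ℝ] E) :
    e L (ball 0 1) = 0 := by
  refine LinearEquiv.induction_on_dilatransvections
    (P := fun L : E ≃ₗ[ℝ] E => ∀ {e : (E → E) → Set E → ℤ}, IsDegreeLike e →
      e id (ball 0 1) = 0 → e L (ball 0 1) = 0) (fun T hT => ?_) (fun S T hS hT => ?_) L he hid
  · obtain ⟨l, v, hlv⟩ := hT
    intro e he hid
    have hTx : ∀ x, T x = x + l x • v := fun x => LinearMap.congr_fun hlv x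
    rcases lt_trichotomy (1 + l v) 0 with h | h | h
    · exact he.linearEquiv_of_dual_neg hid T l v hTx h
    · have hv : v = 0 := (map_eq_zero_iff T T.injective).1 <| by
        rw [hTx, eq_neg_of_add_eq_zero_right h, neg_one_smul, add_neg_cancel]
      simp [hv] at h
    · exact he.linearEquiv_of_dual_pos hid T l v hTx h
  · intro e he hid
    exact hT (he.comp_linearEquiv S) (hS he hid)

theorem eq_zero_of_hasFDerivAt (he : IsDegreeLike e) (hid : e id (ball 0 1) = 0) {f : E → E}
    (hf : Continuous f) {L : E ≃L[ℝ] E} {a : E} (hfa : HasFDerivAt f (L : E →L[ℝ] E) a)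
    (h0 : f a = 0) : ∀ᶠ r in 𝓝[>] (0 : ℝ), e f (ball a r) = 0 := by
  obtain ⟨C, hC⟩ : ∃ C : ℝ, 0 < C ∧ ∀ x, ‖x‖ ≤ C * ‖L x‖ := by
    refine ⟨‖(L.symm : E →L[ℝ] E)‖ + 1, by positivity, fun x => ?_⟩
    have := (L.symm : E →L[ℝ] E).le_opNorm (L x)
    simp only [ContinuousLinearEquiv.coe_coe, ContinuousLinearEquiv.symm_apply_apply] at this
    nlinarith [norm_nonneg (L x)]
  have hsmall := hfa.isLittleO.bound (c := (2 * C)⁻¹) (by have := hC.1; positivity)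
  obtain ⟨ε, hε, hball⟩ := Metric.eventually_nhds_iff_ball.1 hsmall
  filter_upwards [Ioo_mem_nhdsGT hε] with r hr
  have hLc : Continuous fun x => L.toLinearEquiv (x - a) :=
    L.continuous.comp (continuous_id.sub continuous_const)
  rw [← he.linearEquiv_eq_zero hid L.toLinearEquiv,
    ← he.linearEquiv_translate L.toLinearEquiv isOpen_ball isBounded_ball (mem_ball_self one_pos)
      isOpen_ball isBounded_ball (mem_ball_self hr.1)]
  symm
  refine he.eq_of_norm_sub_lt isOpen_ball isBounded_ball hLc.continuousOn hf.continuousOn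
    fun x hx => ?_
  have hxr : ‖x - a‖ = r := mem_sphere_iff_norm.1 (frontier_ball_subset_sphere hx)
  have h1 := hball x (by rw [mem_ball, dist_eq_norm, hxr]; exact hr.2)
  rw [h0, sub_zero] at h1
  have h2 := hC.2 (x - a)
  have h3 : ‖f x - L (x - a)‖ ≤ (2 * C)⁻¹ * ‖x - a‖ := h1
  change ‖f x - L (x - a)‖ < ‖L (x - a)‖
  have h4 : (2 * C)⁻¹ * ‖x - a‖ ≤ ‖L (x - a)‖ / 2 := by
    rw [inv_mul_le_iff₀ (by linarith [hC.1])]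
    linarith
  have h5 : 0 < ‖L (x - a)‖ := by
    by_contra h
    have : ‖L (x - a)‖ = 0 := le_antisymm (not_lt.1 h) (norm_nonneg _)
    rw [this, hxr] at h2
    linarith [hr.1]
  linarith

theorem eq_zero_of_finite_zeros (he : IsDegreeLike e) (hid : e id (ball 0 1) = 0) {f : E → E}
    (hf : Continuous f) (hreg : ∀ x, f x = 0 → ∃ L : E ≃L[ℝ] E, HasFDerivAt f (L : E →L[ℝ] E) x)
    {Z : Set E} (hZ : Z.Finite) : ∀ {A : Set E}, IsOpen A → Bornology.IsBounded A →
      (∀ x ∈ frontier A, f x ≠ 0) → {x ∈ A | f x = 0} = Z → e f A = 0 := by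
  induction Z, hZ using Set.Finite.induction_on with
  | empty =>
    intro A hA hb hfr hz
    refine he.eq_zero_of_forall_ne hA hb hf.continuousOn fun x hx h => ?_
    by_cases hxA : x ∈ A
    · exact (hz.subset ⟨hxA, h⟩ : x ∈ (∅ : Set E))
    · exact hfr x (hA.frontier_eq ▸ ⟨hx, hxA⟩) h
  | @insert a Z ha hZ ih =>
    intro A hA hb hfr hz
    obtain ⟨haA, ha0⟩ : a ∈ {x ∈ A | f x = 0} := hz ▸ mem_insert a Z
    obtain ⟨L, hL⟩ := hreg a ha0
    have hU : A \ Z ∈ 𝓝 a := (hA.sdiff hZ.isClosed).mem_nhds ⟨haA, ha⟩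
    obtain ⟨ε, hε, hεU⟩ := Metric.mem_nhds_iff.1 hU
    obtain ⟨r, hr0, hr⟩ := ((he.eq_zero_of_hasFDerivAt hid hf hL ha0).and
      (Ioo_mem_nhdsGT hε)).exists
    have hcb : closedBall a r ⊆ A \ Z := (closedBall_subset_ball hr.2).trans hεU
    have hA' : IsOpen (A \ closedBall a r) := hA.sdiff isClosed_closedBall
    have hb' : Bornology.IsBounded (A \ closedBall a r) := hb.subset sdiff_subset
    have hzero : ∀ x ∈ A, f x = 0 → x = a ∨ x ∈ Z := fun x hx h => hz.subset ⟨hx, h⟩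
    have hball : ∀ x ∈ closure A, f x = 0 → x ∈ ball a r ∪ A \ closedBall a r := by
      intro x hx h
      have hxA : x ∈ A := by
        by_contra hxA
        exact hfr x (hA.frontier_eq ▸ ⟨hx, hxA⟩) h
      rcases hzero x hxA h with rfl | hxZ
      · exact Or.inl (mem_ball_self hr.1)
      · exact Or.inr ⟨hxA, fun hx' => (hcb hx').2 hxZ⟩
    rw [he.additivity f A (ball a r) (A \ closedBall a r) hA hb isOpen_ball hA'
      (ball_subset_closedBall.trans (hcb.trans sdiff_subset)) sdiff_subset
      (disjoint_left.2 fun x hx hx' => hx'.2 (ball_subset_closedBall hx)) hf.continuousOn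
      (fun x hx h => hx.2 (hball x hx.1 h)), hr0, zero_add]
    refine ih hA' hb' (fun x hx h => ?_) (Subset.antisymm (fun x hx => ?_) fun x hx => ?_)
    · rw [hA'.frontier_eq] at hx
      rcases hball x (closure_mono sdiff_subset hx.1) h with hx' | hx'
      · have : closure (A \ closedBall a r) ⊆ (ball a r)ᶜ :=
          closure_minimal (fun y hy hy' => hy.2 (ball_subset_closedBall hy'))
            isOpen_ball.isClosed_compl
        exact this hx.1 hx'
      · exact hx.2 hx'
    · rcases hzero x hx.1.1 hx.2 with rfl | hxZ
      · exact (hx.1.2 (mem_closedBall_self hr.1.le)).elim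
      · exact hxZ
    · have hx' : x ∈ {x ∈ A | f x = 0} := hz ▸ mem_insert_of_mem a hx
      exact ⟨⟨hx'.1, fun h => (hcb h).2 hx⟩, hx'.2⟩

/-- A degree-like function that vanishes on the identity vanishes on all admissible pairs. -/
theorem eq_zero (he : IsDegreeLike e) (hid : e id (ball 0 1) = 0) {f : E → E} {A : Set E}
    (hA : IsOpen A) (hb : Bornology.IsBounded A) (hf : ContinuousOn f (closure A))
    (h0 : ∀ x ∈ frontier A, f x ≠ 0) : e f A = 0 := by
  have hcA : IsCompact (closure A) := hb.isCompact_closure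
  obtain ⟨m, hm, hmf⟩ := (hcA.of_isClosed_subset isClosed_frontier
    frontier_subset_closure).exists_forall_le' (hf.mono frontier_subset_closure).norm
    fun x hx => norm_pos_iff.2 (h0 x hx)
  obtain ⟨F, hF⟩ := ContinuousMap.exists_restrict_eq isClosed_closure
    (⟨(closure A).domRestrict f, hf.domRestrict⟩ : C(closure A, E))
  have hFf : ∀ x ∈ closure A, F x = f x := fun x hx => DFunLike.congr_fun hF ⟨x, hx⟩
  obtain ⟨g, hg, hgF, -⟩ := F.continuous.exists_contDiff_approx 1
    (continuous_const (y := m / 2)) fun _ => half_pos hm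
  obtain ⟨y, hy, hreg⟩ :=
    ContDiff.exists_norm_lt_forall_eq_exists_hasFDerivAt (by exact_mod_cast hg) (half_pos hm)
  have hgc : Continuous fun x => g x - y := hg.continuous.sub continuous_const
  have hclose : ∀ x ∈ closure A, ‖(g x - y) - f x‖ < m := fun x hx => by
    have h1 := hgF x
    rw [hFf x hx, dist_eq_norm] at h1
    have h2 := norm_sub_le (g x - f x) y
    rw [sub_right_comm]
    linarith
  rw [he.eq_of_norm_sub_lt hA hb hf hgc.continuousOn fun x hx =>
    (hclose x (frontier_subset_closure hx)).trans_le (hmf x hx)]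
  have hfr : ∀ x ∈ frontier A, g x - y ≠ 0 := fun x hx h => by
    have h1 := hclose x (frontier_subset_closure hx)
    rw [h, zero_sub, norm_neg] at h1
    exact absurd (hmf x hx) (not_le.2 h1)
  have hregy : ∀ x, g x - y = 0 → ∃ L : E ≃L[ℝ] E,
      HasFDerivAt (fun x => g x - y) (L : E →L[ℝ] E) x := fun x hx =>
    let ⟨L, hL⟩ := hreg x (sub_eq_zero.1 hx)
    ⟨L, hL.sub_const y⟩
  refine he.eq_zero_of_finite_zeros hid hgc hregy ?_ hA hb hfr rfl
  by_contra hinf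
  obtain ⟨x, -, hx⟩ := Set.Infinite.exists_accPt_of_subset_isCompact hinf hcA
    fun x hx => subset_closure hx.1
  have hx0 : g x - y = 0 := by
    have : x ∈ closure {x | g x - y = 0} :=
      closure_mono (fun z hz => hz.2) (mem_closure_iff_clusterPt.2 hx.clusterPt)
    rwa [(isClosed_eq hgc continuous_const).closure_eq] at this
  obtain ⟨L, hL⟩ := hregy x hx0
  have hne := hL.eventually_ne (c := 0) ⟨_, L.antilipschitz⟩
  obtain ⟨z, hz, hz'⟩ := ((accPt_iff_frequently_nhdsNE.1 hx).and_eventually hne).exists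
  exact hz' hz.2

end FiniteDimensional

end IsDegreeLike

end VanishingTheorem

namespace DegreeTheory

variable (D : DegreeTheory) {E₁ E₂ : Type}
  [NormedAddCommGroup E₁] [NormedSpace ℝ E₁] [FiniteDimensional ℝ E₁]
  [NormedAddCommGroup E₂] [NormedSpace ℝ E₂] [FiniteDimensional ℝ E₂]

theorem isDegreeLike_deg : IsDegreeLike fun (f : E₁ → E₁) A => D.deg E₁ f A 0 where
  additivity f A A₁ A₂ h1 h2 h3 h4 h5 h6 h7 h8 h9 :=
    D.additivity E₁ f A A₁ A₂ 0 h1 h2 h3 h4 h5 h6 h7 h8 h9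
  homotopyInvariance H A h1 h2 h3 h4 := D.homotopyInvariance E₁ H A 0 h1 h2 h3 h4

theorem isDegreeLike_prod_left {f₂ : E₂ → E₂} {A₂ : Set E₂} (hA₂ : IsOpen A₂)
    (hb₂ : Bornology.IsBounded A₂) (hf₂ : ContinuousOn f₂ (closure A₂))
    (hbd₂ : ∀ x ∈ frontier A₂, f₂ x ≠ 0) :
    IsDegreeLike fun (f : E₁ → E₁) A =>
      D.deg (E₁ × E₂) (fun p => (f p.1, f₂ p.2)) (A ×ˢ A₂) 0 where
  additivity f A B C hA hb hB hC hBA hCA hBC hf h0 := by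
    refine D.additivity (E₁ × E₂) _ (A ×ˢ A₂) (B ×ˢ A₂) (C ×ˢ A₂) 0 (hA.prod hA₂) (hb.prod hb₂)
      (hB.prod hA₂) (hC.prod hA₂) (prod_mono_left hBA) (prod_mono_left hCA)
      (disjoint_prod.2 (Or.inl hBC)) ?_ ?_
    · rw [closure_prod_eq]
      exact hf.prodMap hf₂
    · rintro ⟨x, y⟩ hp h
      rw [closure_prod_eq, ← union_prod] at hp
      obtain ⟨hx, hy⟩ := Prod.mk.inj h
      refine hp.2 ⟨by_contra fun hx' => h0 x ⟨hp.1.1, hx'⟩ hx, by_contra fun hy' => ?_⟩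
      exact hbd₂ y (hA₂.frontier_eq ▸ ⟨hp.1.2, hy'⟩) hy
  homotopyInvariance H A hA hb hH h0 := by
    refine D.homotopyInvariance (E₁ × E₂) (fun t p => (H t p.1, f₂ p.2)) (A ×ˢ A₂) 0
      (hA.prod hA₂) (hb.prod hb₂) ?_ ?_
    · rw [closure_prod_eq]
      exact (hH.comp (f := fun p : ℝ × E₁ × E₂ => (p.1, p.2.1)) (by fun_prop)
        fun p hp => ⟨hp.1, hp.2.1⟩).prodMk
        (hf₂.comp (f := fun p : ℝ × E₁ × E₂ => p.2.2) (by fun_prop) fun p hp => hp.2.2)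
    · rintro t ht ⟨x, y⟩ hp h
      obtain ⟨hx, hy⟩ := Prod.mk.inj h
      rw [frontier_prod_eq] at hp
      rcases hp with hp | hp
      · exact hbd₂ y hp.2 hy
      · exact h0 t ht x hp.1 hx

theorem isDegreeLike_prod_right {f₁ : E₁ → E₁} {A₁ : Set E₁} (hA₁ : IsOpen A₁)
    (hb₁ : Bornology.IsBounded A₁) (hf₁ : ContinuousOn f₁ (closure A₁))
    (hbd₁ : ∀ x ∈ frontier A₁, f₁ x ≠ 0) :
    IsDegreeLike fun (f : E₂ → E₂) A =>
      D.deg (E₁ × E₂) (fun p => (f₁ p.1, f p.2)) (A₁ ×ˢ A) 0 where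
  additivity f A B C hA hb hB hC hBA hCA hBC hf h0 := by
    refine D.additivity (E₁ × E₂) _ (A₁ ×ˢ A) (A₁ ×ˢ B) (A₁ ×ˢ C) 0 (hA₁.prod hA) (hb₁.prod hb)
      (hA₁.prod hB) (hA₁.prod hC) (prod_mono_right hBA) (prod_mono_right hCA)
      (disjoint_prod.2 (Or.inr hBC)) ?_ ?_
    · rw [closure_prod_eq]
      exact hf₁.prodMap hf
    · rintro ⟨x, y⟩ hp h
      rw [closure_prod_eq, ← prod_union] at hp
      obtain ⟨hx, hy⟩ := Prod.mk.inj h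
      refine hp.2 ⟨by_contra fun hx' => ?_, by_contra fun hy' => h0 y ⟨hp.1.2, hy'⟩ hy⟩
      exact hbd₁ x (hA₁.frontier_eq ▸ ⟨hp.1.1, hx'⟩) hx
  homotopyInvariance H A hA hb hH h0 := by
    refine D.homotopyInvariance (E₁ × E₂) (fun t p => (f₁ p.1, H t p.2)) (A₁ ×ˢ A) 0
      (hA₁.prod hA) (hb₁.prod hb) ?_ ?_
    · rw [closure_prod_eq]
      exact (hf₁.comp (f := fun p : ℝ × E₁ × E₂ => p.2.1) (by fun_prop)
        fun p hp => hp.2.1).prodMk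
        (hH.comp (f := fun p : ℝ × E₁ × E₂ => (p.1, p.2.2)) (by fun_prop)
          fun p hp => ⟨hp.1, hp.2.2⟩)
    · rintro t ht ⟨x, y⟩ hp h
      obtain ⟨hx, hy⟩ := Prod.mk.inj h
      rw [frontier_prod_eq] at hp
      rcases hp with hp | hp
      · exact h0 t ht y hp.2 hy
      · exact hbd₁ x hp.1 hx

variable (E₁) in
theorem deg_id_ball : D.deg E₁ id (ball 0 1) 0 = 1 :=
  D.normalization E₁ _ 0 isOpen_ball isBounded_ball (mem_ball_self one_pos)

theorem deg_id_prod {f₂ : E₂ → E₂} {A₂ : Set E₂} (hA₂ : IsOpen A₂)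
    (hb₂ : Bornology.IsBounded A₂) (hf₂ : ContinuousOn f₂ (closure A₂))
    (hbd₂ : ∀ x ∈ frontier A₂, f₂ x ≠ 0) :
    D.deg (E₁ × E₂) (fun p => (id p.1, f₂ p.2)) (ball 0 1 ×ˢ A₂) 0 = D.deg E₂ f₂ A₂ 0 := by
  have hfr : ∀ x ∈ frontier (ball (0 : E₁) 1), id x ≠ 0 := by
    rintro x hx rfl
    simpa using frontier_ball_subset_sphere hx
  have hid : D.deg (E₁ × E₂) (fun p => (id p.1, id p.2)) (ball 0 1 ×ˢ ball 0 1) 0 = 1 :=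
    D.normalization (E₁ × E₂) _ 0 (isOpen_ball.prod isOpen_ball)
      (isBounded_ball.prod isBounded_ball) ⟨mem_ball_self one_pos, mem_ball_self one_pos⟩
  have he := (D.isDegreeLike_prod_right (E₂ := E₂) isOpen_ball isBounded_ball continuousOn_id
    hfr).sub D.isDegreeLike_deg
  exact sub_eq_zero.1 (he.eq_zero (by rw [hid, D.deg_id_ball, sub_self]) hA₂ hb₂ hf₂ hbd₂)

end DegreeTheory

/-- Product formula for the Brouwer degree: if `f(x₁,x₂) = (f₁(x₁), f₂(x₂))` is a product
vector field on `A = A₁ × A₂`, with `f₁ ≠ 0` on `∂A₁` and `f₂ ≠ 0` on `∂A₂`, then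
`deg(f, A, 0) = deg(f₁, A₁, 0) · deg(f₂, A₂, 0)`. -/
theorem degree_product_formula (D : DegreeTheory)
    (E₁ E₂ : Type) [NormedAddCommGroup E₁] [NormedSpace ℝ E₁] [FiniteDimensional ℝ E₁]
    [NormedAddCommGroup E₂] [NormedSpace ℝ E₂] [FiniteDimensional ℝ E₂]
    (A₁ : Set E₁) (A₂ : Set E₂)
    (hA₁ : IsOpen A₁) (hA₂ : IsOpen A₂)
    (hb₁ : Bornology.IsBounded A₁) (hb₂ : Bornology.IsBounded A₂)
    (f₁ : E₁ → E₁) (f₂ : E₂ → E₂)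
    (hf₁ : ContinuousOn f₁ (closure A₁)) (hf₂ : ContinuousOn f₂ (closure A₂))
    (hbd₁ : ∀ x ∈ frontier A₁, f₁ x ≠ 0) (hbd₂ : ∀ x ∈ frontier A₂, f₂ x ≠ 0) :
    D.deg (E₁ × E₂) (fun p => (f₁ p.1, f₂ p.2)) (A₁ ×ˢ A₂) 0 =
      D.deg E₁ f₁ A₁ 0 * D.deg E₂ f₂ A₂ 0 := by
  have he := (D.isDegreeLike_prod_left (E₁ := E₁) hA₂ hb₂ hf₂ hbd₂).sub
    (D.isDegreeLike_deg.mul_const (D.deg E₂ f₂ A₂ 0))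
  refine sub_eq_zero.1 (he.eq_zero ?_ hA₁ hb₁ hf₁ hbd₁)
  rw [D.deg_id_prod hA₂ hb₂ hf₂ hbd₂, D.deg_id_ball, one_mul, sub_self]
end
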